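/- arXiv:1707.05094 — 4 statements merged into one kernel-verified Lean document; each statement's English description precedes it below -/
import Mathlib

section
/- Let m ≥ 1 and a be integers. Then for every c ∈ (1, 4/3) there exists ε > 0 such that, uniformly for x ≥ 1, #{n ≤ x : s_Z(⌊n^c⌋) ≡ a (mod m)} = x/m + O(x^{1−ε}), the count being over positive integers n ≤ x. -/
open scoped BigOperators

/-- `l` is (the list of indices of) the Zeckendorf representation of `n`:
a strictly decreasing list of indices `≥ 2`, no two consecutive, whose
Fibonacci numbers sum to `n`. -/
def IsZeckRep (l : List ℕ) (n : ℕ) : Prop :=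
  l.Chain' (fun a b => b + 2 ≤ a) ∧ (∀ i ∈ l, 2 ≤ i) ∧ (l.map Nat.fib).sum = n

/-- The Zeckendorf sum-of-digits function: the number of summands in the
Zeckendorf representation of `n` (and `sZ 0 = 0`). -/
noncomputable def sZ (n : ℕ) : ℕ :=
  sInf {k | ∃ l : List ℕ, IsZeckRep l n ∧ l.length = k}

section ZeckendorfDigits

theorem isZeckRep_iff {l : List ℕ} {n : ℕ} : IsZeckRep l n ↔ n.zeckendorf = l := by
  have key : ∀ l : List ℕ, l.IsZeckendorfRep ↔
      l.IsChain (fun a b => b + 2 ≤ a) ∧ ∀ i ∈ l, 2 ≤ i := by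
    intro l
    induction l with
    | nil => simp
    | cons a l ih =>
      cases l with
      | nil => simp [List.IsZeckendorfRep]
      | cons b l =>
        simp only [List.IsZeckendorfRep, List.cons_append, List.isChain_cons_cons,
          List.mem_cons] at ih ⊢
        rw [ih]
        constructor
        · rintro ⟨h1, h2, h3⟩
          refine ⟨⟨h1, h2⟩, ?_⟩
          rintro i (rfl | hi)
          · omega
          · exact h3 i hi
        · rintro ⟨⟨h1, h2⟩, h3⟩
          exact ⟨h1, h2, fun i hi => h3 i (Or.inr hi)⟩
  constructor
  · rintro ⟨h1, h2, h3⟩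
    rw [← h3]
    exact Nat.zeckendorf_sum_fib ((key l).2 ⟨h1, h2⟩)
  · rintro rfl
    have h := (key _).1 (Nat.isZeckendorfRep_zeckendorf n)
    exact ⟨h.1, h.2, Nat.sum_zeckendorf_fib n⟩

theorem sZ_eq_length (n : ℕ) : sZ n = n.zeckendorf.length := by
  have : {k | ∃ l : List ℕ, IsZeckRep l n ∧ l.length = k} = {n.zeckendorf.length} := by
    ext k
    simp [isZeckRep_iff, eq_comm]
  rw [sZ, this, csInf_singleton]

theorem sZ_fib_succ_add {k v : ℕ} (hv : v < Nat.fib k) :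
    sZ (Nat.fib (k + 1) + v) = sZ v + 1 := by
  have hk : k ≠ 0 := by rintro rfl; simp at hv
  have hg : Nat.greatestFib (Nat.fib (k + 1) + v) = k + 1 := by
    apply le_antisymm
    · rw [← Nat.lt_succ_iff, Nat.greatestFib_lt, Nat.succ_eq_add_one, Nat.fib_add_two]
      omega
    · exact Nat.le_greatestFib.2 (by omega)
  have hpos : 0 < Nat.fib (k + 1) + v := by
    have := Nat.fib_pos.2 (Nat.succ_pos k)
    simp only [Nat.succ_eq_add_one] at this
    omega
  rw [sZ_eq_length, sZ_eq_length, Nat.zeckendorf_of_pos hpos, hg]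
  simp

end ZeckendorfDigits

section FibonacciMultiplicative

/-- A sequence of complex numbers of modulus at most one which picks up the factor `ω`
whenever a leading Zeckendorf digit is added. -/
structure FibMultiplicative (ω : ℂ) (φ : ℕ → ℂ) : Prop where
  norm_const : ‖ω‖ = 1
  norm_le : ∀ n, ‖φ n‖ ≤ 1
  fib_succ_add : ∀ k v, v < Nat.fib k → φ (Nat.fib (k + 1) + v) = ω * φ v

theorem fibMultiplicative_pow_sZ {ω : ℂ} (hω : ‖ω‖ = 1) :
    FibMultiplicative ω (fun n => ω ^ sZ n) where
  norm_const := hω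
  norm_le n := by simp [hω]
  fib_succ_add k v hv := by
    simp only [sZ_fib_succ_add hv]
    ring

variable {ω : ℂ} {φ : ℕ → ℂ}

theorem FibMultiplicative.sum_range_fib_add_two (h : FibMultiplicative ω φ) (k : ℕ) :
    ∑ v ∈ Finset.range (Nat.fib (k + 2)), φ v =
      ∑ v ∈ Finset.range (Nat.fib (k + 1)), φ v +
        ω * ∑ v ∈ Finset.range (Nat.fib k), φ v := by
  rw [Nat.fib_add_two, add_comm (Nat.fib k), Finset.sum_range_add, Finset.mul_sum]
  congr 1
  exact Finset.sum_congr rfl fun v hv => h.fib_succ_add k v (Finset.mem_range.1 hv)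

theorem norm_one_add_lt_two (hω : ‖ω‖ = 1) (h1 : ω ≠ 1) : ‖1 + ω‖ < 2 := by
  have hray : ¬ SameRay ℝ (1 : ℂ) ω := by
    intro h
    have := (sameRay_iff_of_norm_eq (by simp [hω])).1 h
    exact h1 this.symm
  calc ‖1 + ω‖ < ‖(1 : ℂ)‖ + ‖ω‖ := norm_add_lt_of_not_sameRay hray
    _ = 2 := by rw [hω]; norm_num

theorem goldenRatio_pow_le_fib (k : ℕ) :
    Real.goldenRatio ^ k ≤ Nat.fib (k + 2) ∧ Real.goldenRatio ^ (k + 1) ≤ Nat.fib (k + 3) := by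
  induction k with
  | zero =>
    simp [Nat.fib_add_two, Real.goldenRatio_lt_two.le]
  | succ k ih =>
    refine ⟨ih.2, ?_⟩
    have : Nat.fib (k + 1 + 3) = Nat.fib (k + 2) + Nat.fib (k + 3) := Nat.fib_add_two
    rw [this, show k + 1 + 1 = k + 2 from rfl, pow_add, Real.goldenRatio_sq]
    push_cast
    have h1 := ih.1
    have h2 := ih.2
    rw [pow_add] at h2
    rw [pow_one] at h2
    linarith

theorem exists_rpow_goldenRatio_cube {q : ℝ} (hq : q < 2) :
    ∃ η : ℝ, 0 < η ∧ η < 1 ∧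
      q * Real.goldenRatio ^ (1 - η) + 1 ≤ (Real.goldenRatio ^ (1 - η)) ^ 3 := by
  have hc : Continuous fun η : ℝ => (Real.goldenRatio ^ (1 - η)) ^ 3 -
      (q * Real.goldenRatio ^ (1 - η) + 1) := by
    have : Continuous fun η : ℝ => Real.goldenRatio ^ (1 - η) :=
      Real.continuous_const_rpow Real.goldenRatio_pos.ne' |>.comp (by fun_prop)
    fun_prop
  have h0 : 0 < (Real.goldenRatio ^ (1 - (0 : ℝ))) ^ 3 -
      (q * Real.goldenRatio ^ (1 - (0 : ℝ)) + 1) := by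
    rw [sub_zero, Real.rpow_one]
    have := Real.goldenRatio_sq
    have hp := Real.goldenRatio_pos
    have h3 : Real.goldenRatio ^ 3 = 2 * Real.goldenRatio + 1 := by
      rw [pow_succ, this, add_mul, ← sq, this]; ring
    nlinarith
  obtain ⟨d, hd, hball⟩ := Metric.eventually_nhds_iff.1 (hc.continuousAt.eventually_const_lt h0)
  refine ⟨min (d / 2) (1 / 2), by positivity, by
    have := min_le_right (d / 2) (1 / 2 : ℝ); linarith, ?_⟩
  have hm := min_le_left (d / 2) (1 / 2 : ℝ)
  have hm0 : 0 < min (d / 2) (1 / 2 : ℝ) := by positivity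
  have := hball (y := min (d / 2) (1 / 2)) (by
    rw [Real.dist_eq, sub_zero, abs_of_pos hm0]; linarith)
  linarith

/-- A twisted sequence has power saving cancellation along Fibonacci numbers. -/
theorem FibMultiplicative.exists_norm_sum_le (h : FibMultiplicative ω φ) (h1 : ω ≠ 1) :
    ∃ η C : ℝ, 0 < η ∧ η < 1 ∧ 0 ≤ C ∧ ∀ k : ℕ,
      ‖∑ v ∈ Finset.range (Nat.fib (k + 2)), φ v‖ ≤ C * (Nat.fib (k + 2) : ℝ) ^ (1 - η) := by
  obtain ⟨η, h0, hlt, hη⟩ := exists_rpow_goldenRatio_cube (norm_one_add_lt_two h.norm_const h1)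
  set ρ := Real.goldenRatio ^ (1 - η) with hρ
  have hρ1 : 1 ≤ ρ := Real.one_le_rpow Real.one_lt_goldenRatio.le (by linarith)
  set S : ℕ → ℂ := fun k => ∑ v ∈ Finset.range (Nat.fib k), φ v with hS
  have hrec : ∀ k, S (k + 2) = S (k + 1) + ω * S k := h.sum_range_fib_add_two
  have hbase : ∀ k, ‖S k‖ ≤ Nat.fib k := fun k => by
    refine (norm_sum_le _ _).trans ?_
    refine (Finset.sum_le_sum fun v _ => h.norm_le v).trans ?_
    simp
  have hbound : ∀ k, ‖S k‖ ≤ ρ ^ k ∧ ‖S (k + 1)‖ ≤ ρ ^ (k + 1) ∧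
      ‖S (k + 2)‖ ≤ ρ ^ (k + 2) := by
    intro k
    induction k with
    | zero =>
      refine ⟨by simp [hS], (hbase 1).trans ?_, (hbase 2).trans ?_⟩
      · simpa using hρ1
      · simpa using one_le_pow₀ (n := 2) hρ1
    | succ k ih =>
      refine ⟨ih.2.1, ih.2.2, ?_⟩
      have e : S (k + 1 + 2) = (1 + ω) * S (k + 1) + ω * S k := by
        rw [hrec (k + 1), hrec k]; ring
      have hk : 0 ≤ ρ ^ k := by positivity
      calc ‖S (k + 1 + 2)‖ ≤ ‖1 + ω‖ * ‖S (k + 1)‖ + ‖S k‖ := by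
            rw [e]
            refine (norm_add_le _ _).trans ?_
            rw [norm_mul, norm_mul, h.norm_const, one_mul]
        _ ≤ ‖1 + ω‖ * ρ ^ (k + 1) + ρ ^ k := by
            gcongr
            · exact ih.2.1
            · exact ih.1
        _ = ρ ^ k * (‖1 + ω‖ * ρ + 1) := by ring
        _ ≤ ρ ^ k * ρ ^ 3 := by gcongr
        _ = ρ ^ (k + 1 + 2) := by ring
  refine ⟨η, ρ ^ 2, h0, hlt, by positivity, fun k => ((hbound k).2.2).trans ?_⟩
  rw [pow_add, mul_comm]
  gcongr
  rw [hρ, ← Real.rpow_natCast, ← Real.rpow_mul Real.goldenRatio_pos.le, mul_comm,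
    Real.rpow_mul Real.goldenRatio_pos.le, Real.rpow_natCast]
  exact Real.rpow_le_rpow (by have := Real.goldenRatio_pos; positivity)
    (goldenRatio_pow_le_fib k).1 (by linarith)

end FibonacciMultiplicative

section TrigonometricSums

open Complex in
/-- The additive character `x ↦ exp (2πix)` of the real line. -/
noncomputable def expi (x : ℝ) : ℂ := Complex.exp ((2 * Real.pi * x : ℝ) * I)

theorem expi_add (x y : ℝ) : expi (x + y) = expi x * expi y := by
  rw [expi, expi, expi, ← Complex.exp_add]
  congr 1
  push_cast
  ring

@[simp]
theorem expi_zero : expi 0 = 1 := by simp [expi]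

@[simp]
theorem norm_expi (x : ℝ) : ‖expi x‖ = 1 := Complex.norm_exp_ofReal_mul_I _

theorem expi_int (n : ℤ) : expi n = 1 := by
  rw [expi, Complex.exp_eq_one_iff]
  exact ⟨n, by push_cast; ring⟩

theorem conj_expi (x : ℝ) : (starRingEnd ℂ) (expi x) = expi (-x) := by
  rw [expi, expi, ← Complex.exp_conj, map_mul, Complex.conj_ofReal, Complex.conj_I]
  congr 1
  push_cast
  ring

theorem expi_nat_mul (n : ℕ) (x : ℝ) : expi (n * x) = expi x ^ n := by
  rw [expi, expi, ← Complex.exp_nat_mul]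
  congr 1
  push_cast
  ring

@[fun_prop]
theorem continuous_expi : Continuous expi := by
  unfold expi
  fun_prop

theorem hasDerivAt_expi_mul (n x : ℝ) :
    HasDerivAt (fun t : ℝ => expi (n * t)) (2 * Real.pi * n * Complex.I * expi (n * x)) x := by
  have h : HasDerivAt (fun t : ℝ => ((2 * Real.pi * (n * t) : ℝ) : ℂ) * Complex.I)
      ((2 * Real.pi * n : ℝ) * Complex.I) x := by
    refine HasDerivAt.mul_const ?_ _
    refine HasDerivAt.ofReal_comp ?_
    simpa [mul_assoc] using (hasDerivAt_id x).const_mul (2 * Real.pi * n)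
  have := h.cexp
  unfold expi
  convert this using 1
  push_cast
  ring

theorem integral_expi_int_mul (n : ℤ) (a : ℝ) :
    ∫ t in a..(a + 1), expi (n * t) = if n = 0 then 1 else 0 := by
  split_ifs with hn
  · simp [hn]
  · have hn' : (n : ℂ) ≠ 0 := by exact_mod_cast hn
    have hpi : (2 * Real.pi * n * Complex.I : ℂ) ≠ 0 := by
      simp [hn, Real.pi_ne_zero]
    have hd : ∀ x ∈ Set.uIcc a (a + 1),
        HasDerivAt (fun t : ℝ => (2 * Real.pi * n * Complex.I : ℂ)⁻¹ * expi (n * t))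
          (expi (n * x)) x := by
      intro x _
      have := (hasDerivAt_expi_mul n x).const_mul ((2 * Real.pi * n * Complex.I : ℂ)⁻¹)
      rwa [Complex.ofReal_intCast, ← mul_assoc, inv_mul_cancel₀ hpi, one_mul] at this
    rw [intervalIntegral.integral_eq_sub_of_hasDerivAt hd
      ((continuous_expi.comp (by fun_prop)).intervalIntegrable _ _)]
    rw [mul_add, expi_add, mul_one, expi_int]
    simp

theorem integral_sum_sum {f : ℕ → ℕ → ℝ → ℂ} (hf : ∀ i j, Continuous (f i j)) (n : ℕ) (a b : ℝ) :
    ∫ t in a..b, ∑ i ∈ Finset.range n, ∑ j ∈ Finset.range n, f i j t =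
      ∑ i ∈ Finset.range n, ∑ j ∈ Finset.range n, ∫ t in a..b, f i j t := by
  rw [intervalIntegral.integral_finsetSum fun i _ =>
    (continuous_finsetSum _ fun j _ => hf i j).intervalIntegrable _ _]
  exact Finset.sum_congr rfl fun i _ =>
    intervalIntegral.integral_finsetSum fun j _ => (hf i j).intervalIntegrable _ _

/-- The exponential sum with coefficients `a`, of length `n`, at frequency `θ`. -/
noncomputable def trigSum (a : ℕ → ℂ) (n : ℕ) (θ : ℝ) : ℂ :=
  ∑ v ∈ Finset.range n, a v * expi (v * θ)

theorem continuous_trigSum (a : ℕ → ℂ) (n : ℕ) : Continuous (trigSum a n) := by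
  unfold trigSum
  refine continuous_finsetSum _ fun v _ => continuous_const.mul ?_
  exact continuous_expi.comp (by fun_prop)

theorem trigSum_zero (a : ℕ → ℂ) (n : ℕ) : trigSum a n 0 = ∑ v ∈ Finset.range n, a v := by
  simp [trigSum]

theorem periodic_trigSum (a : ℕ → ℂ) (n : ℕ) : Function.Periodic (trigSum a n) 1 := by
  intro θ
  refine Finset.sum_congr rfl fun v _ => ?_
  rw [mul_add, expi_add, mul_one]
  have := expi_int v
  rw [Int.cast_natCast] at this
  rw [this, mul_one]

theorem norm_trigSum_le {a : ℕ → ℂ} (ha : ∀ v, ‖a v‖ ≤ 1) (n : ℕ) (θ : ℝ) :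
    ‖trigSum a n θ‖ ≤ n := by
  refine (norm_sum_le _ _).trans ?_
  refine (Finset.sum_le_sum (g := fun _ => (1 : ℝ)) fun v _ => ?_).trans (by simp)
  simpa using ha v

theorem norm_sq_trigSum (a : ℕ → ℂ) (n : ℕ) (θ : ℝ) :
    ((‖trigSum a n θ‖ ^ 2 : ℝ) : ℂ) =
      ∑ v ∈ Finset.range n, ∑ w ∈ Finset.range n,
        a v * (starRingEnd ℂ) (a w) * expi (((v : ℤ) - w : ℤ) * θ) := by
  rw [Complex.ofReal_pow, ← Complex.mul_conj', trigSum, map_sum, Finset.sum_mul_sum]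
  refine Finset.sum_congr rfl fun v _ => Finset.sum_congr rfl fun w _ => ?_
  rw [map_mul, conj_expi]
  push_cast
  rw [sub_mul, sub_eq_add_neg, expi_add]
  ring

theorem integral_norm_sq_trigSum (a : ℕ → ℂ) (n : ℕ) (x : ℝ) :
    ∫ θ in x..(x + 1), ‖trigSum a n θ‖ ^ 2 = ∑ v ∈ Finset.range n, ‖a v‖ ^ 2 := by
  have : ((∫ θ in x..(x + 1), ‖trigSum a n θ‖ ^ 2 : ℝ) : ℂ) =
      ((∑ v ∈ Finset.range n, ‖a v‖ ^ 2 : ℝ) : ℂ) := by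
    rw [← intervalIntegral.integral_ofReal]
    simp_rw [norm_sq_trigSum]
    rw [integral_sum_sum (f := fun v w θ =>
      a v * (starRingEnd ℂ) (a w) * expi (((v : ℤ) - w : ℤ) * θ)) fun v w => by fun_prop]
    push_cast
    refine Finset.sum_congr rfl fun v hv => ?_
    simp_rw [intervalIntegral.integral_const_mul, ← Int.cast_natCast (R := ℝ), ← Int.cast_sub]
    simp_rw [integral_expi_int_mul]
    rw [Finset.sum_eq_single v]
    · simp [Complex.mul_conj']
    · intro w _ hw
      rw [if_neg (by omega), mul_zero]
    · exact fun h => absurd hv h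
  exact_mod_cast this

theorem integral_norm_sq_trigSum_le {a : ℕ → ℂ} (ha : ∀ v, ‖a v‖ ≤ 1) (n : ℕ) {x y : ℝ}
    (hxy : x ≤ y) : ∫ θ in x..y, ‖trigSum a n θ‖ ^ 2 ≤ (y - x + 1) * n := by
  have hcont : Continuous fun θ => ‖trigSum a n θ‖ ^ 2 := (continuous_trigSum a n).norm.pow 2
  have hper : Function.Periodic (fun θ => ‖trigSum a n θ‖ ^ 2) 1 := fun θ => by
    simp only [periodic_trigSum a n θ]
  have h1 : ∫ θ in x..(x + 1), ‖trigSum a n θ‖ ^ 2 ≤ n := by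
    rw [integral_norm_sq_trigSum]
    refine (Finset.sum_le_sum (g := fun _ => (1 : ℝ)) fun v _ => ?_).trans (by simp)
    exact pow_le_one₀ (norm_nonneg _) (ha v)
  set m : ℕ := ⌈y - x⌉₊ with hm
  have hym : y ≤ x + m := by linarith [Nat.le_ceil (y - x)]
  have hm1 : (m : ℝ) ≤ y - x + 1 := (Nat.ceil_lt_add_one (by linarith)).le
  calc ∫ θ in x..y, ‖trigSum a n θ‖ ^ 2 ≤ ∫ θ in x..(x + m), ‖trigSum a n θ‖ ^ 2 := by
        refine intervalIntegral.integral_mono_interval le_rfl hxy hym ?_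
          (hcont.intervalIntegrable _ _)
        exact Filter.Eventually.of_forall fun θ => by positivity
    _ = m * ∫ θ in x..(x + 1), ‖trigSum a n θ‖ ^ 2 := by
        have h := hper.intervalIntegral_add_zsmul_eq m x
          (fun u v => hcont.intervalIntegrable u v)
        simp only [zsmul_eq_mul, Int.cast_natCast, mul_one] at h
        rw [h]
    _ ≤ m * n := by gcongr
    _ ≤ (y - x + 1) * n := by gcongr

end TrigonometricSums

section FejerKernel

/-- The Fejér kernel of order `H`. -/
noncomputable def fejer (H : ℕ) (t : ℝ) : ℝ := ‖trigSum (fun _ => 1) H t‖ ^ 2 / H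

theorem continuous_fejer (H : ℕ) : Continuous (fejer H) :=
  ((continuous_trigSum _ H).norm.pow 2).div_const _

theorem fejer_nonneg (H : ℕ) (t : ℝ) : 0 ≤ fejer H t := by
  unfold fejer
  positivity

theorem periodic_fejer (H : ℕ) : Function.Periodic (fejer H) 1 := fun t => by
  simp only [fejer, periodic_trigSum _ H t]

theorem integral_fejer {H : ℕ} (hH : H ≠ 0) (x : ℝ) : ∫ t in x..(x + 1), fejer H t = 1 := by
  unfold fejer
  rw [intervalIntegral.integral_div, integral_norm_sq_trigSum]
  simp [hH]

theorem norm_trigSum_one_le {H : ℕ} {t : ℝ} (ht : |t| ≤ 1 / 2) :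
    2 * |t| * ‖trigSum (fun _ => 1) H t‖ ≤ 1 := by
  have hgeom : trigSum (fun _ => 1) H t * (expi t - 1) = expi t ^ H - 1 := by
    rw [← geom_sum_mul, trigSum]
    congr 1
    exact Finset.sum_congr rfl fun v _ => by rw [one_mul, expi_nat_mul]
  have hsin : 4 * |t| ≤ ‖expi t - 1‖ := by
    have h := Complex.norm_exp_I_mul_ofReal_sub_one (2 * Real.pi * t)
    rw [mul_comm Complex.I] at h
    rw [expi, h, norm_mul, Real.norm_eq_abs, Real.norm_eq_abs, abs_two,
      show 2 * Real.pi * t / 2 = Real.pi * t by ring]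
    have h2 : 2 * |t| ≤ |Real.sin (Real.pi * t)| := by
      have := Real.mul_abs_le_abs_sin (x := Real.pi * t) (by
        rw [abs_mul, abs_of_pos Real.pi_pos]
        nlinarith [Real.pi_pos])
      rw [abs_mul, abs_of_pos Real.pi_pos, ← mul_assoc,
        div_mul_cancel₀ _ Real.pi_ne_zero] at this
      exact this
    linarith
  have hle : ‖expi t ^ H - 1‖ ≤ 2 := by
    refine (norm_sub_le _ _).trans ?_
    rw [norm_pow, norm_expi]
    norm_num
  rw [← hgeom, norm_mul] at hle
  nlinarith [norm_nonneg (trigSum (fun _ => 1) H t)]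

theorem fejer_le {H : ℕ} (hH : H ≠ 0) {t : ℝ} (ht : |t| ≤ 1 / 2) :
    fejer H t ≤ 2 * H / (1 + 4 * H ^ 2 * t ^ 2) := by
  have hH' : (0 : ℝ) < H := by positivity
  have h1 : ‖trigSum (fun _ => 1) H t‖ ≤ H := norm_trigSum_le (by simp) H t
  have h2 := norm_trigSum_one_le (H := H) ht
  set S := ‖trigSum (fun _ => 1) H t‖ with hS
  have hS0 : 0 ≤ S := norm_nonneg _
  have h3 : S ^ 2 ≤ H ^ 2 := by gcongr
  have h4 : 4 * t ^ 2 * S ^ 2 ≤ 1 := by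
    have : (2 * |t| * S) ^ 2 ≤ 1 := pow_le_one₀ (by positivity) h2
    rw [mul_pow, mul_pow, sq_abs] at this
    linarith
  rw [fejer, div_le_div_iff₀ hH' (by positivity)]
  nlinarith

theorem integral_abs_mul_fejer_le {H : ℕ} (hH : H ≠ 0) :
    ∫ t in (-(1 / 2) : ℝ)..(1 / 2), |t| * fejer H t ≤ Real.log (1 + H ^ 2) / (2 * H) := by
  have hH' : (0 : ℝ) < H := by positivity
  set q : ℝ → ℝ := fun t => |t| * (2 * H / (1 + 4 * H ^ 2 * t ^ 2)) with hq
  have hqc : Continuous q := by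
    refine continuous_abs.mul (Continuous.div continuous_const (by fun_prop) fun t => ?_)
    positivity
  have hpos : ∫ t in (0 : ℝ)..(1 / 2), q t = Real.log (1 + H ^ 2) / (4 * H) := by
    have hd : ∀ x ∈ Set.uIcc (0 : ℝ) (1 / 2), HasDerivAt
        (fun t : ℝ => Real.log (1 + 4 * H ^ 2 * t ^ 2) / (4 * H)) (q x) x := by
      intro x hx
      rw [Set.uIcc_of_le (by norm_num)] at hx
      have h0 : (1 + 4 * (H : ℝ) ^ 2 * x ^ 2) ≠ 0 := by positivity
      have := ((((hasDerivAt_pow 2 x).const_mul (4 * (H : ℝ) ^ 2)).const_add 1).log h0).div_const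
        (4 * (H : ℝ))
      refine this.congr_deriv ?_
      simp only [hq, abs_of_nonneg hx.1]
      field_simp
      push_cast
      ring
    rw [intervalIntegral.integral_eq_sub_of_hasDerivAt hd (hqc.intervalIntegrable _ _)]
    simp only [ne_eq, OfNat.ofNat_ne_zero, not_false_eq_true, zero_pow, mul_zero, add_zero,
      Real.log_one, zero_div, sub_zero]
    congr 3
    ring
  have hneg : ∫ t in (-(1 / 2) : ℝ)..0, q t = ∫ t in (0 : ℝ)..(1 / 2), q t := by
    have := intervalIntegral.integral_comp_neg (a := (0 : ℝ)) (b := 1 / 2) q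
    rw [neg_zero] at this
    rw [← this]
    refine intervalIntegral.integral_congr fun t _ => ?_
    simp only [hq, abs_neg, neg_sq]
  calc ∫ t in (-(1 / 2) : ℝ)..(1 / 2), |t| * fejer H t ≤ ∫ t in (-(1 / 2) : ℝ)..(1 / 2), q t := by
        refine intervalIntegral.integral_mono_on (by norm_num)
          ((continuous_abs.mul (continuous_fejer H)).intervalIntegrable _ _)
          (hqc.intervalIntegrable _ _) fun t ht => ?_
        exact mul_le_mul_of_nonneg_left (fejer_le hH (abs_le.2 ht)) (abs_nonneg _)
    _ = Real.log (1 + H ^ 2) / (2 * H) := by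
        rw [← intervalIntegral.integral_add_adjacent_intervals (b := 0)
          (hqc.intervalIntegrable _ _) (hqc.intervalIntegrable _ _), hneg, hpos]
        field_simp
        ring

/-- Sampling a Lipschitz function at an integer agrees with averaging against the Fejér kernel. -/
theorem norm_sub_integral_mul_fejer_le {g : ℝ → ℂ} {Λ : ℝ}
    (hg : ∀ s t, ‖g s - g t‖ ≤ Λ * |s - t|) (hgc : Continuous g) {H : ℕ} (hH : H ≠ 0) (n : ℕ) :
    ‖g n - ∫ s in ((n : ℝ) - 1 / 2)..(n + 1 / 2), g s * fejer H s‖ ≤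
      Λ * (Real.log (1 + H ^ 2) / (2 * H)) := by
  have hΛ : 0 ≤ Λ := by
    have := (norm_nonneg _).trans (hg 1 0)
    simpa using this
  have hfn : ∀ t, fejer H (t + n) = fejer H t := fun t => by
    simpa using (periodic_fejer H).nat_mul n t
  have e1 : ∫ s in ((n : ℝ) - 1 / 2)..(n + 1 / 2), g s * fejer H s =
      ∫ t in (-(1 / 2) : ℝ)..(1 / 2), g (t + n) * fejer H t := by
    have := intervalIntegral.integral_comp_add_right (a := -(1 / 2)) (b := 1 / 2)
      (fun s => g s * fejer H s) (n : ℝ)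
    simp only [hfn] at this
    rw [this]
    congr 1 <;> ring
  have e2 : g n = ∫ t in (-(1 / 2) : ℝ)..(1 / 2), g n * fejer H t := by
    have h1 := integral_fejer hH (-(1 / 2))
    rw [show (-(1 / 2) : ℝ) + 1 = 1 / 2 by norm_num] at h1
    rw [intervalIntegral.integral_const_mul, intervalIntegral.integral_ofReal, h1]
    simp
  have hfc : Continuous fun t => ((fejer H t : ℝ) : ℂ) :=
    Complex.continuous_ofReal.comp (continuous_fejer H)
  have hgn : Continuous fun t : ℝ => g (t + n) := hgc.comp (by fun_prop)
  have hg0 : Continuous fun _ : ℝ => g n := continuous_const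
  rw [e1]
  nth_rw 1 [e2]
  rw [← intervalIntegral.integral_sub (f := fun t => g n * ((fejer H t : ℝ) : ℂ))
    (g := fun t => g (t + n) * ((fejer H t : ℝ) : ℂ)) ((hg0.mul hfc).intervalIntegrable _ _)
    ((hgn.mul hfc).intervalIntegrable _ _)]
  calc ‖∫ t in (-(1 / 2) : ℝ)..(1 / 2), (g n * fejer H t - g (t + n) * fejer H t)‖
      ≤ ∫ t in (-(1 / 2) : ℝ)..(1 / 2), Λ * (|t| * fejer H t) := by
        refine intervalIntegral.norm_integral_le_of_norm_le (by norm_num) ?_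
          ((continuous_const.mul (continuous_abs.mul (continuous_fejer H))).intervalIntegrable _ _)
        refine Filter.Eventually.of_forall fun t _ => ?_
        rw [← sub_mul, norm_mul, Complex.norm_real, Real.norm_of_nonneg (fejer_nonneg H t),
          ← mul_assoc]
        refine mul_le_mul_of_nonneg_right ((hg _ _).trans_eq ?_) (fejer_nonneg H t)
        congr 1
        rw [← abs_neg]
        congr 1
        ring
    _ ≤ Λ * (Real.log (1 + H ^ 2) / (2 * H)) := by
        rw [intervalIntegral.integral_const_mul]
        gcongr
        exact integral_abs_mul_fejer_le hH

theorem norm_sum_sub_integral_mul_fejer_le {g : ℝ → ℂ} {Λ : ℝ}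
    (hg : ∀ s t, ‖g s - g t‖ ≤ Λ * |s - t|) (hgc : Continuous g) {H : ℕ} (hH : H ≠ 0)
    (M : ℕ) (S : Finset ℕ) (hS : ∀ n ∉ S, ∀ s : ℝ, |s - n| ≤ 1 / 2 → g s = 0) :
    ‖∑ n ∈ Finset.range M, g n - ∫ s in (-(1 / 2) : ℝ)..(M - 1 / 2), g s * fejer H s‖ ≤
      S.card * (Λ * (Real.log (1 + H ^ 2) / (2 * H))) := by
  have hfc : Continuous fun t => g t * ((fejer H t : ℝ) : ℂ) :=
    hgc.mul (Complex.continuous_ofReal.comp (continuous_fejer H))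
  have hadj := intervalIntegral.sum_integral_adjacent_intervals (n := M)
    (a := fun n : ℕ => (n : ℝ) - 1 / 2) (f := fun s => g s * ((fejer H s : ℝ) : ℂ))
    (μ := MeasureTheory.volume) (fun k _ => hfc.intervalIntegrable _ _)
  simp only [Nat.cast_zero, zero_sub, Nat.cast_add, Nat.cast_one] at hadj
  rw [← hadj, ← Finset.sum_sub_distrib]
  have hshift : ∀ n : ℕ, (n : ℝ) + 1 - 1 / 2 = n + 1 / 2 := fun n => by ring
  simp only [hshift]
  have hΛ : 0 ≤ Λ * (Real.log (1 + H ^ 2) / (2 * H)) :=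
    (norm_nonneg _).trans (norm_sub_integral_mul_fejer_le hg hgc hH 0)
  refine (norm_sum_le _ _).trans ?_
  have hterm : ∀ n ∈ Finset.range M,
      ‖g n - ∫ s in ((n : ℝ) - 1 / 2)..(n + 1 / 2), g s * fejer H s‖ ≤
        if n ∈ S then Λ * (Real.log (1 + H ^ 2) / (2 * H)) else 0 := by
    intro n _
    split_ifs with hn
    · exact norm_sub_integral_mul_fejer_le hg hgc hH n
    · rw [hS n hn n (by simp), intervalIntegral.integral_congr (g := fun _ => (0 : ℂ))]
      · simp
      · intro s hs
        rw [Set.uIcc_of_le (by linarith)] at hs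
        simp only
        rw [hS n hn s (abs_le.2 ⟨by linarith [hs.1], by linarith [hs.2]⟩), zero_mul]
  refine (Finset.sum_le_sum hterm).trans ?_
  rw [← Finset.sum_filter, Finset.sum_const, nsmul_eq_mul]
  refine mul_le_mul_of_nonneg_right ?_ hΛ
  exact_mod_cast Finset.card_le_card fun n hn => (Finset.mem_filter.1 hn).2

theorem integral_mul_fejer {g : ℝ → ℂ} (hgc : Continuous g) (H : ℕ) (a b : ℝ) :
    ∫ s in a..b, g s * fejer H s =
      (H : ℂ)⁻¹ * ∑ j ∈ Finset.range H, ∑ l ∈ Finset.range H,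
        ∫ s in a..b, g s * expi (((j : ℤ) - l : ℤ) * s) := by
  have hpt : ∀ s, g s * fejer H s = (H : ℂ)⁻¹ * ∑ j ∈ Finset.range H, ∑ l ∈ Finset.range H,
      g s * expi (((j : ℤ) - l : ℤ) * s) := by
    intro s
    rw [fejer, Complex.ofReal_div, norm_sq_trigSum, Complex.ofReal_natCast]
    simp only [map_one, one_mul, ← Finset.mul_sum]
    ring
  simp_rw [hpt]
  rw [intervalIntegral.integral_const_mul, integral_sum_sum
    (f := fun j l s => g s * expi (((j : ℤ) - l : ℤ) * s)) fun j l => by fun_prop]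

end FejerKernel

section BlockFunctions

/-- A Lipschitz function with values in `[0, 1]` which vanishes outside the unit interval. -/
structure IsBump (L : ℝ) (T : ℝ → ℝ) : Prop where
  nonneg : ∀ x, 0 ≤ T x
  le_one : ∀ x, T x ≤ 1
  abs_sub_le : ∀ x y, |T x - T y| ≤ L * |x - y|
  eq_zero_of_nonpos : ∀ x ≤ 0, T x = 0
  eq_zero_of_one_le : ∀ x, 1 ≤ x → T x = 0

variable {L : ℝ} {T : ℝ → ℝ} {ω : ℂ} {φ : ℕ → ℂ}

theorem IsBump.lipschitz_nonneg (hT : IsBump L T) : 0 ≤ L := by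
  have := (abs_nonneg _).trans (hT.abs_sub_le 1 0)
  simpa using this

theorem IsBump.continuous (hT : IsBump L T) : Continuous T := by
  have : LipschitzWith L.toNNReal T := LipschitzWith.of_dist_le_mul fun x y => by
    rw [Real.coe_toNNReal _ hT.lipschitz_nonneg, Real.dist_eq, Real.dist_eq]
    exact hT.abs_sub_le x y
  exact this.continuous

theorem IsBump.hasCompactSupport (hT : IsBump L T) : HasCompactSupport T := by
  refine HasCompactSupport.intro (isCompact_Icc (a := (0 : ℝ)) (b := 1)) fun x hx => ?_
  rw [Set.mem_Icc, not_and_or, not_le, not_le] at hx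
  rcases hx with h | h
  · exact hT.eq_zero_of_nonpos x h.le
  · exact hT.eq_zero_of_one_le x h.le

/-- The function equal to `φ v * T (y - v)` on the intervals `[v, v + 1]`, `v < Z`. -/
noncomputable def blockFun (φ : ℕ → ℂ) (T : ℝ → ℝ) (Z : ℕ) (y : ℝ) : ℂ :=
  ∑ v ∈ Finset.range Z, φ v * T (y - v)

theorem IsBump.apply_sub_eq_zero (hT : IsBump L T) {y : ℝ} {v : ℕ} (h : v ≠ ⌊y⌋₊) :
    T (y - v) = 0 := by
  rcases lt_or_gt_of_ne h with h | h
  · refine hT.eq_zero_of_one_le _ ?_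
    have h1 : v + 1 ≤ ⌊y⌋₊ := h
    have h2 := (Nat.le_floor_iff' (by omega)).1 h1
    push_cast at h2
    linarith
  · refine hT.eq_zero_of_nonpos _ ?_
    have := (Nat.floor_lt' (by omega)).1 h
    linarith

theorem blockFun_eq (hT : IsBump L T) (Z : ℕ) (y : ℝ) :
    blockFun φ T Z y = if ⌊y⌋₊ < Z then φ ⌊y⌋₊ * T (y - ⌊y⌋₊) else 0 := by
  split_ifs with h
  · refine Finset.sum_eq_single _ (fun v _ hv => ?_) fun h' => absurd (Finset.mem_range.2 h) h'
    rw [hT.apply_sub_eq_zero hv, Complex.ofReal_zero, mul_zero]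
  · refine Finset.sum_eq_zero fun v hv => ?_
    have := Finset.mem_range.1 hv
    rw [hT.apply_sub_eq_zero (by omega), Complex.ofReal_zero, mul_zero]

theorem blockFun_eq_zero_of_nonpos (hT : IsBump L T) (Z : ℕ) {y : ℝ} (hy : y ≤ 0) :
    blockFun φ T Z y = 0 := by
  refine Finset.sum_eq_zero fun v _ => ?_
  rw [hT.eq_zero_of_nonpos _ (by have := Nat.cast_nonneg (α := ℝ) v; linarith),
    Complex.ofReal_zero, mul_zero]

theorem blockFun_eq_zero_of_le (hT : IsBump L T) {Z : ℕ} {y : ℝ} (hy : Z ≤ y) :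
    blockFun φ T Z y = 0 := by
  refine Finset.sum_eq_zero fun v hv => ?_
  have h : v + 1 ≤ Z := Finset.mem_range.1 hv
  have h' : (v : ℝ) + 1 ≤ Z := by exact_mod_cast h
  rw [hT.eq_zero_of_one_le _ (by linarith), Complex.ofReal_zero, mul_zero]

theorem continuous_blockFun (hT : IsBump L T) (Z : ℕ) : Continuous (blockFun φ T Z) := by
  have := hT.continuous
  unfold blockFun
  fun_prop

theorem norm_blockFun_le (hφ : ∀ v, ‖φ v‖ ≤ 1) (hT : IsBump L T) (Z : ℕ) (y : ℝ) :
    ‖blockFun φ T Z y‖ ≤ 1 := by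
  rw [blockFun_eq hT]
  split_ifs
  · rw [norm_mul, Complex.norm_real, Real.norm_of_nonneg (hT.nonneg _)]
    exact mul_le_one₀ (hφ _) (hT.nonneg _) (hT.le_one _)
  · simp

theorem norm_blockFun_sub_le (hφ : ∀ v, ‖φ v‖ ≤ 1) (hT : IsBump L T) (Z : ℕ) (x y : ℝ) :
    ‖blockFun φ T Z x - blockFun φ T Z y‖ ≤ 2 * L * |x - y| := by
  have hL := hT.lipschitz_nonneg
  rw [blockFun, blockFun, ← Finset.sum_sub_distrib]
  calc ‖∑ v ∈ Finset.range Z, (φ v * T (x - v) - φ v * T (y - v))‖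
      ≤ ∑ v ∈ Finset.range Z, ‖φ v * T (x - v) - φ v * T (y - v)‖ := norm_sum_le _ _
    _ ≤ ∑ v ∈ Finset.range Z, if v ∈ ({⌊x⌋₊, ⌊y⌋₊} : Finset ℕ) then L * |x - y| else 0 := by
        refine Finset.sum_le_sum fun v _ => ?_
        split_ifs with h
        · rw [← mul_sub, ← Complex.ofReal_sub, norm_mul, Complex.norm_real, Real.norm_eq_abs]
          have h1 := hT.abs_sub_le (x - v) (y - v)
          rw [sub_sub_sub_cancel_right] at h1
          calc ‖φ v‖ * |T (x - v) - T (y - v)| ≤ 1 * (L * |x - y|) := by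
                gcongr
                exact hφ v
            _ = L * |x - y| := one_mul _
        · simp only [Finset.mem_insert, Finset.mem_singleton, not_or] at h
          rw [hT.apply_sub_eq_zero h.1, hT.apply_sub_eq_zero h.2]
          simp
    _ ≤ (({⌊x⌋₊, ⌊y⌋₊} : Finset ℕ).card : ℝ) * (L * |x - y|) := by
        rw [← Finset.sum_filter, Finset.sum_const, nsmul_eq_mul]
        refine mul_le_mul_of_nonneg_right ?_ (by positivity)
        exact_mod_cast Finset.card_le_card fun n hn => (Finset.mem_filter.1 hn).2
    _ ≤ 2 * (L * |x - y|) := by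
        refine mul_le_mul_of_nonneg_right ?_ (by positivity)
        exact_mod_cast Finset.card_le_two
    _ = 2 * L * |x - y| := by ring

theorem FibMultiplicative.blockFun_add (h : FibMultiplicative ω φ) {k z : ℕ}
    (hz : z ≤ Nat.fib k) (y : ℝ) :
    blockFun φ T (Nat.fib (k + 1) + z) y =
      blockFun φ T (Nat.fib (k + 1)) y + ω * blockFun φ T z (y - Nat.fib (k + 1)) := by
  rw [blockFun, Finset.sum_range_add, blockFun, blockFun, Finset.mul_sum]
  congr 1
  refine Finset.sum_congr rfl fun v hv => ?_
  rw [h.fib_succ_add k v ((Finset.mem_range.1 hv).trans_le hz), mul_assoc]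
  push_cast
  rw [sub_sub]

theorem norm_integral_blockFun_mul_expi_le (hT : IsBump L T) (Z : ℕ) {α : ℝ} (hα : 0 < α)
    (β h : ℝ) {a b : ℝ} (hab : a ≤ b)
    (hsupp : ∀ s, 0 < α * s + β → α * s + β < Z → s ∈ Set.Ioc a b) :
    ‖∫ s in a..b, blockFun φ T Z (α * s + β) * expi (h * s)‖ ≤
      (∫ u, T u) / α * ‖trigSum φ Z (h / α)‖ := by
  have hc := hT.continuous
  set G : ℝ → ℂ := fun u => T u * expi (h / α * u) with hG
  have hGint : MeasureTheory.Integrable G := by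
    refine Continuous.integrable_of_hasCompactSupport (by fun_prop) ?_
    refine HasCompactSupport.mul_right ?_
    exact hT.hasCompactSupport.comp_left (g := ((↑) : ℝ → ℂ)) Complex.ofReal_zero
  have hcomp : ∀ d, ∫ s, G (α * s + d) = (α⁻¹ : ℝ) * ∫ u, G u := by
    intro d
    rw [MeasureTheory.Measure.integral_comp_mul_left (fun s => G (s + d)) α,
      MeasureTheory.integral_add_right_eq_self G d, abs_of_pos (inv_pos.2 hα)]
    simp
  have hcompI : ∀ d, MeasureTheory.Integrable fun s => G (α * s + d) := fun d =>
    (hGint.comp_add_right d).comp_mul_left' hα.ne'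
  have hpt : ∀ s, blockFun φ T Z (α * s + β) * expi (h * s) =
      ∑ v ∈ Finset.range Z, φ v * expi (h / α * (v - β)) * G (α * s + (β - v)) := by
    intro s
    rw [blockFun, Finset.sum_mul]
    refine Finset.sum_congr rfl fun v _ => ?_
    have : expi (h * s) = expi (h / α * (v - β)) * expi (h / α * (α * s + (β - v))) := by
      rw [← expi_add]
      congr 1
      field_simp
      ring
    simp only [hG]
    rw [this, add_sub_assoc]
    ring
  have hfull : ∫ s in a..b, blockFun φ T Z (α * s + β) * expi (h * s) =
      ∫ s, blockFun φ T Z (α * s + β) * expi (h * s) := by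
    rw [intervalIntegral.integral_of_le hab]
    refine MeasureTheory.setIntegral_eq_integral_of_forall_compl_eq_zero fun s hs => ?_
    rcases le_or_gt (α * s + β) 0 with h0 | h0
    · rw [blockFun_eq_zero_of_nonpos hT _ h0, zero_mul]
    · rcases le_or_gt (Z : ℝ) (α * s + β) with h1 | h1
      · rw [blockFun_eq_zero_of_le hT h1, zero_mul]
      · exact absurd (hsupp s h0 h1) hs
  have hval : ∫ s, blockFun φ T Z (α * s + β) * expi (h * s) =
      (α⁻¹ : ℝ) * (∫ u, G u) * expi (-(h / α * β)) * trigSum φ Z (h / α) := by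
    simp_rw [hpt]
    rw [MeasureTheory.integral_finsetSum _ fun v _ => (hcompI _).const_mul _, trigSum,
      Finset.mul_sum]
    refine Finset.sum_congr rfl fun v _ => ?_
    rw [MeasureTheory.integral_const_mul, hcomp, mul_sub, sub_eq_add_neg, expi_add,
      mul_comm (h / α) (v : ℝ)]
    ring
  have hGle : ‖∫ u, G u‖ ≤ ∫ u, T u := by
    refine (MeasureTheory.norm_integral_le_integral_norm _).trans_eq ?_
    refine MeasureTheory.integral_congr_ae (Filter.Eventually.of_forall fun u => ?_)
    simp only [hG, norm_mul, norm_expi, mul_one, Complex.norm_real,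
      Real.norm_of_nonneg (hT.nonneg u)]
  rw [hfull, hval, norm_mul, norm_mul, norm_mul, norm_expi, Complex.norm_real,
    Real.norm_of_nonneg (inv_pos.2 hα).le, mul_one]
  refine mul_le_mul_of_nonneg_right ?_ (norm_nonneg _)
  rw [div_eq_inv_mul]
  gcongr

end BlockFunctions

section Linearization

theorem rpow_linear_approx {c s σ : ℝ} (hc : 1 < c) (hc2 : c < 2) (hs : 0 ≤ s) (hσ : 0 < σ) :
    σ ^ c + c * σ ^ (c - 1) * (s - σ) ≤ s ^ c ∧
      s ^ c ≤ σ ^ c + c * σ ^ (c - 1) * (s - σ) + (c - 1) * (s - σ) ^ 2 * σ ^ (c - 2) := by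
  obtain ⟨z, hz⟩ : ∃ z, s = σ * (1 + z) := ⟨s / σ - 1, by field_simp; ring⟩
  have hz1 : 0 ≤ 1 + z := by
    rw [hz] at hs
    exact nonneg_of_mul_nonneg_right hs hσ
  have e1 : σ ^ (c - 1) = σ ^ c / σ := by rw [Real.rpow_sub_one hσ.ne']
  have e2 : σ ^ (c - 2) = σ ^ c / σ ^ 2 := by
    rw [Real.rpow_sub hσ, Real.rpow_two]
  have hp : 0 < σ ^ c := Real.rpow_pos_of_pos hσ c
  have hb1 := one_add_mul_self_le_rpow_one_add (s := z) (by linarith) hc.le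
  have hb2 : (1 + z) ^ c ≤ (1 + z) * (1 + (c - 1) * z) := by
    have h := rpow_one_add_le_one_add_mul_self (s := z) (p := c - 1) (by linarith)
      (by linarith) (by linarith)
    calc (1 + z) ^ c = (1 + z) * (1 + z) ^ (c - 1) := by
          rw [mul_comm, ← Real.rpow_add_one' hz1 (by linarith), sub_add_cancel]
      _ ≤ _ := by gcongr
  have e3 : s ^ c = σ ^ c * (1 + z) ^ c := by rw [hz, Real.mul_rpow hσ.le hz1]
  have e4 : s - σ = σ * z := by rw [hz]; ring
  rw [e3, e4, e1, e2]
  constructor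
  · calc σ ^ c + c * (σ ^ c / σ) * (σ * z) = σ ^ c * (1 + c * z) := by field_simp
      _ ≤ _ := by gcongr
  · calc σ ^ c * (1 + z) ^ c ≤ σ ^ c * ((1 + z) * (1 + (c - 1) * z)) := by gcongr
      _ = _ := by field_simp; ring

end Linearization

section ShortSums

theorem card_le_of_forall_mem_Icc {S : Finset ℕ} {a b : ℝ} (hab : a ≤ b + 1)
    (hS : ∀ n ∈ S, a ≤ n ∧ (n : ℝ) ≤ b) : (S.card : ℝ) ≤ b - a + 1 := by
  rcases S.eq_empty_or_nonempty with rfl | ⟨n, hn⟩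
  · simp
    linarith
  · have h := hS n hn
    have hb : 0 ≤ b := (Nat.cast_nonneg n).trans h.2
    have hsub : S ⊆ Finset.Icc ⌈a⌉₊ ⌊b⌋₊ := fun k hk =>
      Finset.mem_Icc.2 ⟨Nat.ceil_le.2 (hS k hk).1, Nat.le_floor (hS k hk).2⟩
    have h1 : ⌈a⌉₊ ≤ ⌊b⌋₊ := (Nat.ceil_le.2 h.1).trans (Nat.le_floor h.2)
    have h2 := Finset.card_le_card hsub
    rw [Nat.card_Icc] at h2
    have h3 : S.card + ⌈a⌉₊ ≤ ⌊b⌋₊ + 1 := by omega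
    have h4 : (S.card : ℝ) + ⌈a⌉₊ ≤ ⌊b⌋₊ + 1 := by exact_mod_cast h3
    linarith [Nat.floor_le hb, Nat.le_ceil a]

/-- The average of `‖∑ v < Z, φ v * expi (v * h / α)‖` over the spectrum of the Fejér kernel. -/
noncomputable def fejerMean (φ : ℕ → ℂ) (Z H : ℕ) (α : ℝ) : ℝ :=
  (H : ℝ)⁻¹ * ∑ j ∈ Finset.range H, ∑ l ∈ Finset.range H, ‖trigSum φ Z (((j : ℤ) - l : ℤ) / α)‖

variable {L : ℝ} {T : ℝ → ℝ} {φ : ℕ → ℂ}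

theorem norm_integral_blockFun_mul_fejer_le (hT : IsBump L T) (Z H : ℕ) {α : ℝ} (hα : 0 < α)
    (β : ℝ) {a b : ℝ} (hab : a ≤ b)
    (hsupp : ∀ s, 0 < α * s + β → α * s + β < Z → s ∈ Set.Ioc a b) :
    ‖∫ s in a..b, blockFun φ T Z (α * s + β) * fejer H s‖ ≤
      (∫ u, T u) / α * fejerMean φ Z H α := by
  have hc : Continuous fun s => blockFun φ T Z (α * s + β) :=
    (continuous_blockFun hT Z).comp (by fun_prop)
  rw [integral_mul_fejer hc, norm_mul, norm_inv, Complex.norm_natCast, fejerMean, mul_left_comm]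
  gcongr
  simp only [Finset.mul_sum]
  refine (norm_sum_le _ _).trans (Finset.sum_le_sum fun j _ => ?_)
  refine (norm_sum_le _ _).trans (Finset.sum_le_sum fun l _ => ?_)
  exact norm_integral_blockFun_mul_expi_le hT Z hα β _ hab hsupp

theorem norm_sum_blockFun_le (hφ : ∀ v, ‖φ v‖ ≤ 1) (hT : IsBump L T) {c s₁ K w σ : ℝ}
    {Z H M : ℕ} (hc : 1 < c) (hc2 : c < 2) (hs₁ : 1 ≤ s₁) (hw : s₁ ^ c ≤ w)
    (hZ : Z ≤ K * (c * s₁ ^ (c - 1))) (hK : K ≤ s₁) (hσ : 0 ≤ σ) (hσw : w ≤ σ ^ c)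
    (hσZ : σ ^ c ≤ w + Z) (hH : H ≠ 0) (hM : σ + K + 1 ≤ M) :
    ‖∑ n ∈ Finset.range M, blockFun φ T Z ((n : ℝ) ^ c - w)‖ ≤
      (2 * K + 1) * (2 * L * ((c - 1) * K ^ 2 * s₁ ^ (c - 2))) +
      (2 * K + 2) * (2 * L * (c * σ ^ (c - 1)) * (Real.log (1 + H ^ 2) / (2 * H))) +
      (∫ u, T u) / (c * σ ^ (c - 1)) * fejerMean φ Z H (c * σ ^ (c - 1)) := by
  have hL := hT.lipschitz_nonneg
  have hs0 : 0 < s₁ := by linarith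
  have hα₁ : 0 < c * s₁ ^ (c - 1) := by positivity
  have hK0 : 0 ≤ K := nonneg_of_mul_nonneg_left ((Nat.cast_nonneg Z).trans hZ) hα₁
  have hsσ : s₁ ≤ σ := (Real.rpow_le_rpow_iff hs0.le hσ (by linarith)).1 (hw.trans hσw)
  have hσ0 : 0 < σ := by linarith
  set α := c * σ ^ (c - 1) with hα_def
  have hα₁α : c * s₁ ^ (c - 1) ≤ α :=
    mul_le_mul_of_nonneg_left (Real.rpow_le_rpow hs0.le hsσ (by linarith)) (by linarith)
  have hα : 0 < α := hα₁.trans_le hα₁α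
  have hZα : (Z : ℝ) ≤ K * α := hZ.trans (by gcongr)
  set β := σ ^ c - w - α * σ with hβ
  set g : ℝ → ℂ := fun s => blockFun φ T Z (α * s + β) with hg
  have hgc : Continuous g := (continuous_blockFun hT Z).comp (by fun_prop)
  have hgL : ∀ s t, ‖g s - g t‖ ≤ 2 * L * α * |s - t| := fun s t => by
    refine (norm_blockFun_sub_le hφ hT Z _ _).trans_eq ?_
    rw [add_sub_add_right_eq_sub, ← mul_sub, abs_mul, abs_of_pos hα]
    ring
  have hsupp : ∀ s, 0 < α * s + β → α * s + β < Z → |s - σ| < K := by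
    intro s h1 h2
    rw [abs_lt]
    constructor <;> refine lt_of_mul_lt_mul_left (a := α) ?_ hα.le <;> nlinarith
  have hgsupp : ∀ s, K ≤ |s - σ| → g s = 0 := by
    intro s hs
    rcases le_or_gt (α * s + β) 0 with h | h
    · exact blockFun_eq_zero_of_nonpos hT _ h
    · rcases le_or_gt (Z : ℝ) (α * s + β) with h' | h'
      · exact blockFun_eq_zero_of_le hT h'
      · exact absurd (hsupp s h h') hs.not_gt
  have hfsupp : ∀ n : ℕ, K < |n - σ| → blockFun φ T Z ((n : ℝ) ^ c - w) = 0 := by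
    intro n hn
    by_contra hne
    have h1 : 0 < (n : ℝ) ^ c - w := by
      by_contra! h
      exact hne (blockFun_eq_zero_of_nonpos hT _ h)
    have h2 : (n : ℝ) ^ c - w < Z := by
      by_contra! h
      exact hne (blockFun_eq_zero_of_le hT h)
    have hn0 : (0 : ℝ) ≤ n := Nat.cast_nonneg n
    refine hn.not_ge ?_
    rcases le_or_gt σ n with h | h
    · rw [abs_of_nonneg (sub_nonneg.2 h)]
      have := (rpow_linear_approx hc hc2 hn0 hσ0).1
      refine le_of_mul_le_mul_left (a := α) ?_ hα
      linarith
    · have hsn : s₁ ≤ n :=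
        (Real.rpow_le_rpow_iff (z := c) hs0.le hn0 (by linarith)).1 (by linarith)
      rw [abs_of_neg (sub_neg.2 h)]
      have h3 := (rpow_linear_approx hc hc2 hσ (hs0.trans_le hsn)).1
      have h4 : c * s₁ ^ (c - 1) ≤ c * (n : ℝ) ^ (c - 1) :=
        mul_le_mul_of_nonneg_left (Real.rpow_le_rpow hs0.le hsn (by linarith)) (by linarith)
      have h5 := mul_le_mul_of_nonneg_right h4 (by linarith : 0 ≤ σ - n)
      refine le_of_mul_le_mul_left (a := c * s₁ ^ (c - 1)) ?_ hα₁
      linarith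
  have hlin : ‖∑ n ∈ Finset.range M, blockFun φ T Z ((n : ℝ) ^ c - w) -
      ∑ n ∈ Finset.range M, g n‖ ≤
      (2 * K + 1) * (2 * L * ((c - 1) * K ^ 2 * s₁ ^ (c - 2))) := by
    have hE : 0 ≤ 2 * L * ((c - 1) * K ^ 2 * s₁ ^ (c - 2)) := by
      have : 0 ≤ c - 1 := by linarith
      positivity
    rw [← Finset.sum_sub_distrib]
    refine (norm_sum_le _ _).trans ?_
    have hterm : ∀ n ∈ Finset.range M, ‖blockFun φ T Z ((n : ℝ) ^ c - w) - g n‖ ≤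
        if |(n : ℝ) - σ| ≤ K then 2 * L * ((c - 1) * K ^ 2 * s₁ ^ (c - 2)) else 0 := by
      intro n _
      split_ifs with h
      · refine (norm_blockFun_sub_le hφ hT Z _ _).trans ?_
        gcongr
        obtain ⟨h1, h2⟩ := rpow_linear_approx hc hc2 (Nat.cast_nonneg n) hσ0
        have h3 : ((n : ℝ) - σ) ^ 2 ≤ K ^ 2 := sq_le_sq' (abs_le.1 h).1 (abs_le.1 h).2
        have h4 : σ ^ (c - 2) ≤ s₁ ^ (c - 2) :=
          Real.rpow_le_rpow_of_nonpos hs0 hsσ (by linarith)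
        have h5 : (c - 1) * ((n : ℝ) - σ) ^ 2 * σ ^ (c - 2) ≤ (c - 1) * K ^ 2 * s₁ ^ (c - 2) := by
          have : 0 ≤ c - 1 := by linarith
          gcongr
        have h6 : (n : ℝ) ^ c - w - (α * n + β) = n ^ c - (σ ^ c + α * (n - σ)) := by
          rw [hβ]; ring
        rw [h6, abs_of_nonneg (by linarith)]
        linarith
      · rw [hfsupp n (not_le.1 h), hgsupp n (not_le.1 h).le, sub_zero, norm_zero]
    refine (Finset.sum_le_sum hterm).trans ?_
    rw [← Finset.sum_filter, Finset.sum_const, nsmul_eq_mul]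
    refine mul_le_mul_of_nonneg_right ?_ hE
    refine (card_le_of_forall_mem_Icc (a := σ - K) (b := σ + K) (by linarith) fun n hn => ?_).trans
      (by linarith)
    have := abs_le.1 (Finset.mem_filter.1 hn).2
    constructor <;> linarith
  set S := (Finset.range M).filter fun n : ℕ => |(n : ℝ) - σ| ≤ K + 1 / 2 with hS_def
  have hS : ∀ n ∉ S, ∀ s : ℝ, |s - n| ≤ 1 / 2 → g s = 0 := by
    intro n hn s hs
    refine hgsupp s ?_
    by_contra! h
    refine hn (Finset.mem_filter.2 ⟨?_, ?_⟩)
    · rw [Finset.mem_range, ← Nat.cast_lt (α := ℝ)]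
      linarith [abs_lt.1 h, abs_le.1 hs]
    · calc |(n : ℝ) - σ| = |(s - σ) - (s - n)| := by congr 1; ring
        _ ≤ |s - σ| + |s - n| := abs_sub _ _
        _ ≤ _ := by linarith
  have hScard : (S.card : ℝ) ≤ 2 * K + 2 := by
    refine (card_le_of_forall_mem_Icc (a := σ - (K + 1 / 2)) (b := σ + (K + 1 / 2)) (by linarith)
      fun n hn => ?_).trans (by linarith)
    have := abs_le.1 (Finset.mem_filter.1 hn).2
    constructor <;> linarith
  have hfej := norm_sum_sub_integral_mul_fejer_le hgL hgc hH M S hS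
  have hint := norm_integral_blockFun_mul_fejer_le (φ := φ) hT Z H hα β
    (a := -(1 / 2)) (b := M - 1 / 2) (by linarith) fun s h1 h2 => by
      have := abs_lt.1 (hsupp s h1 h2)
      constructor <;> linarith
  have hlog : 0 ≤ 2 * L * α * (Real.log (1 + H ^ 2) / (2 * H)) := by
    have : 0 ≤ Real.log (1 + (H : ℝ) ^ 2) := Real.log_nonneg (by nlinarith)
    positivity
  have hfej' := hfej.trans (mul_le_mul_of_nonneg_right hScard hlog)
  have h1 := norm_le_norm_add_norm_sub' (∑ n ∈ Finset.range M, blockFun φ T Z ((n : ℝ) ^ c - w))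
    (∑ n ∈ Finset.range M, g n)
  have h2 := norm_le_norm_add_norm_sub' (∑ n ∈ Finset.range M, g n)
    (∫ s in (-(1 / 2) : ℝ)..(M - 1 / 2), g s * fejer H s)
  linarith

end ShortSums

section BlockInduction

variable {D : ℕ → ℝ → ℂ} {ω : ℂ} {R : ℝ → ℝ} {r : ℕ} {B w₀ Y : ℝ}

theorem norm_fib_le_of_recurrence (hω : ‖ω‖ = 1)
    (hD : ∀ k z, z ≤ Nat.fib k → ∀ w,
      D (Nat.fib (k + 1) + z) w = D (Nat.fib (k + 1)) w + ω * D z (w + Nat.fib (k + 1)))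
    (hbase : ∀ k, r ≤ k → k ≤ r + 1 → ∀ w, w₀ ≤ w → w + Nat.fib k ≤ Y →
      ‖D (Nat.fib k) w‖ ≤ R (w + Nat.fib k) - R w)
    (k : ℕ) (hk : r ≤ k) : ∀ w, w₀ ≤ w → w + Nat.fib k ≤ Y →
      ‖D (Nat.fib k) w‖ ≤ R (w + Nat.fib k) - R w := by
  induction k using Nat.strong_induction_on with
  | _ k ih =>
    intro w hw hwY
    rcases le_or_gt k (r + 1) with h | h
    · exact hbase k hk h w hw hwY
    · obtain ⟨i, rfl⟩ : ∃ i, k = i + 2 := ⟨k - 2, by omega⟩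
      have hf : (Nat.fib (i + 2) : ℝ) = Nat.fib (i + 1) + Nat.fib i := by
        rw [Nat.fib_add_two]
        push_cast
        ring
      have h0 : (0 : ℝ) ≤ Nat.fib i := Nat.cast_nonneg _
      have h0' : (0 : ℝ) ≤ Nat.fib (i + 1) := Nat.cast_nonneg _
      have h1 := ih (i + 1) (by omega) (by omega) w hw (by linarith)
      have h2 := ih i (by omega) (by omega) (w + Nat.fib (i + 1)) (by linarith) (by linarith)
      have h3 : D (Nat.fib (i + 2)) w =
          D (Nat.fib (i + 1)) w + ω * D (Nat.fib i) (w + Nat.fib (i + 1)) := by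
        rw [← hD i _ le_rfl, Nat.fib_add_two, add_comm]
      have h4 := norm_add_le (D (Nat.fib (i + 1)) w) (ω * D (Nat.fib i) (w + Nat.fib (i + 1)))
      rw [norm_mul, hω, one_mul] at h4
      rw [h3, hf, ← add_assoc]
      linarith

theorem norm_le_of_recurrence (hω : ‖ω‖ = 1)
    (hD : ∀ k z, z ≤ Nat.fib k → ∀ w,
      D (Nat.fib (k + 1) + z) w = D (Nat.fib (k + 1)) w + ω * D z (w + Nat.fib (k + 1)))
    (hbase : ∀ k, r ≤ k → k ≤ r + 1 → ∀ w, w₀ ≤ w → w + Nat.fib k ≤ Y →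
      ‖D (Nat.fib k) w‖ ≤ R (w + Nat.fib k) - R w)
    (hR : Monotone R)
    (hB : ∀ z, z < Nat.fib (r + 1) → ∀ w, w₀ ≤ w → w + z ≤ Y → ‖D z w‖ ≤ B)
    (Z : ℕ) : ∀ w, w₀ ≤ w → w + Z ≤ Y → ‖D Z w‖ ≤ R (w + Z) - R w + B := by
  induction Z using Nat.strong_induction_on with
  | _ Z ih =>
    intro w hw hwY
    have hZ0 : (0 : ℝ) ≤ Z := Nat.cast_nonneg _
    rcases lt_or_ge Z (Nat.fib (r + 1)) with h | h
    · have h1 := hB Z h w hw hwY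
      have h2 : R w ≤ R (w + Z) := hR (by linarith)
      linarith
    · have hg : r + 1 ≤ Nat.greatestFib Z := Nat.le_greatestFib.2 h
      obtain ⟨k, hk⟩ : ∃ k, Nat.greatestFib Z = k + 1 := ⟨Nat.greatestFib Z - 1, by omega⟩
      have h1 := Nat.fib_greatestFib_le Z
      have h2 := Nat.lt_fib_greatestFib_add_one Z
      rw [hk] at h1 h2 hg
      rw [Nat.fib_add_two] at h2
      obtain ⟨z, rfl⟩ := Nat.exists_eq_add_of_le h1
      have hpos : 0 < Nat.fib (k + 1) := Nat.fib_pos.2 (by omega)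
      have hc : ((Nat.fib (k + 1) + z : ℕ) : ℝ) = Nat.fib (k + 1) + z := by push_cast; rfl
      rw [hc] at hwY ⊢
      have hz0 : (0 : ℝ) ≤ z := Nat.cast_nonneg _
      have hf0 : (0 : ℝ) ≤ Nat.fib (k + 1) := Nat.cast_nonneg _
      have h3 := norm_fib_le_of_recurrence hω hD hbase (k + 1) (by omega) w hw (by linarith)
      have h4 := ih z (by omega) (w + Nat.fib (k + 1)) (by linarith) (by linarith)
      rw [hD k z (by omega)]
      have h5 := norm_add_le (D (Nat.fib (k + 1)) w) (ω * D z (w + Nat.fib (k + 1)))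
      rw [norm_mul, hω, one_mul] at h5
      rw [← add_assoc]
      linarith

end BlockInduction

section MeanValue

theorem sum_inv_sqrt_le (n : ℕ) : ∑ i ∈ Finset.range n, (√((i : ℝ) + 1))⁻¹ ≤ 2 * √n := by
  induction n with
  | zero => simp
  | succ n ih =>
    rw [Finset.sum_range_succ]
    push_cast
    have h1 : 0 < √((n : ℝ) + 1) := by positivity
    have h2 : 0 ≤ √(n : ℝ) := by positivity
    have h3 := Real.sq_sqrt (show (0 : ℝ) ≤ n by positivity)
    have h4 := Real.sq_sqrt (show (0 : ℝ) ≤ (n : ℝ) + 1 by positivity)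
    have h5 : (√((n : ℝ) + 1))⁻¹ ≤ 2 * (√((n : ℝ) + 1) - √n) := by
      rw [inv_le_iff_one_le_mul₀ h1]
      nlinarith [sq_nonneg (√((n : ℝ) + 1) - √n)]
    linarith

theorem sum_inv_sqrt_abs_sub_le {H j : ℕ} (hj : j < H) :
    ∑ l ∈ Finset.range H, (√|(((j : ℤ) - l : ℤ) : ℝ)|)⁻¹ ≤ 4 * √H := by
  obtain ⟨d, rfl⟩ := Nat.exists_eq_add_of_lt hj
  rw [Nat.add_assoc, Finset.sum_range_add]
  have h1 : ∑ l ∈ Finset.range j, (√|(((j : ℤ) - l : ℤ) : ℝ)|)⁻¹ ≤ 2 * √j := by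
    rw [← Finset.sum_range_reflect]
    refine le_trans (Finset.sum_le_sum fun i hi => ?_) (sum_inv_sqrt_le j)
    have hi' := Finset.mem_range.1 hi
    have : ((j : ℤ) - (j - 1 - i : ℕ) : ℤ) = i + 1 := by omega
    rw [this]
    push_cast
    rw [abs_of_nonneg (by positivity)]
  have h2 : ∑ l ∈ Finset.range (d + 1), (√|(((j : ℤ) - (j + l : ℕ) : ℤ) : ℝ)|)⁻¹ ≤ 2 * √d := by
    rw [Finset.sum_range_succ']
    have h0 : (((j : ℤ) - (j + 0 : ℕ) : ℤ) : ℝ) = 0 := by push_cast; ring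
    rw [h0, abs_zero, Real.sqrt_zero, inv_zero, add_zero]
    refine le_trans (Finset.sum_le_sum fun i hi => ?_) (sum_inv_sqrt_le d)
    have : (((j : ℤ) - (j + (i + 1) : ℕ) : ℤ) : ℝ) = -(i + 1) := by push_cast; ring
    rw [this, abs_neg, abs_of_nonneg (by positivity)]
  have h3 : √(j : ℝ) ≤ √((j + (d + 1) : ℕ) : ℝ) := Real.sqrt_le_sqrt (by exact_mod_cast by omega)
  have h4 : √(d : ℝ) ≤ √((j + (d + 1) : ℕ) : ℝ) := Real.sqrt_le_sqrt (by exact_mod_cast by omega)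
  linarith

variable {φ : ℕ → ℂ} {c X Y : ℝ}

theorem integral_norm_sq_trigSum_comp_le (hφ : ∀ v, ‖φ v‖ ≤ 1) (hc : 1 < c) (hX : 0 < X)
    (hXY : X ≤ Y) (Z : ℕ) {h : ℝ} (hh : h ≠ 0) :
    ∫ t in X..Y, ‖trigSum φ Z (h / (c * t ^ (1 - 1 / c)))‖ ^ 2 ≤
      c * Y ^ (2 - 1 / c) / (|h| * (1 - 1 / c)) * (|h| / (c * X ^ (1 - 1 / c)) + 1) * Z := by
  have hc0 : 0 < c := by linarith
  set γ := 1 - 1 / c with hγ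
  have hγ0 : 0 < γ := by
    rw [hγ, sub_pos, div_lt_one hc0]
    exact hc
  have hγ1 : 2 - 1 / c = γ + 1 := by rw [hγ]; ring
  rw [hγ1]
  have hY : 0 < Y := hX.trans_le hXY
  set F : ℝ → ℝ := fun θ => ‖trigSum φ Z θ‖ ^ 2 with hF
  have hFc : Continuous F := (continuous_trigSum φ Z).norm.pow 2
  set θ : ℝ → ℝ := fun t => h / (c * t ^ γ) with hθ
  set κ : ℝ → ℝ := fun t => γ / c * t ^ (-γ - 1) with hκ
  have hderiv : ∀ t, 0 < t → HasDerivAt θ (-h * κ t) t := by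
    intro t ht
    have h1 := (Real.hasDerivAt_rpow_const (p := -γ) (Or.inl ht.ne')).const_mul (h / c)
    have h2 : θ =ᶠ[nhds t] fun t => h / c * t ^ (-γ) := by
      filter_upwards [lt_mem_nhds ht] with u hu
      simp only [hθ]
      rw [Real.rpow_neg hu.le]
      field_simp
    refine (h1.congr_of_eventuallyEq h2).congr_deriv ?_
    simp only [hκ]
    ring
  have hpos : ∀ t ∈ Set.uIcc X Y, 0 < t := fun t ht => by
    rw [Set.uIcc_of_le hXY] at ht
    exact hX.trans_le ht.1
  have hθc : ContinuousOn θ (Set.uIcc X Y) := fun t ht =>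
    (hderiv t (hpos t ht)).continuousAt.continuousWithinAt
  have hκc : ContinuousOn κ (Set.uIcc X Y) := by
    refine continuousOn_const.mul (continuousOn_id.rpow_const fun t ht => Or.inl (hpos t ht).ne')
  have hsub : ∫ t in X..Y, (F ∘ θ) t * (-h * κ t) = ∫ u in θ X..θ Y, F u :=
    intervalIntegral.integral_comp_mul_deriv' (fun t ht => hderiv t (hpos t ht))
      (continuousOn_const.mul hκc) hFc.continuousOn
  have hFθ : ContinuousOn (fun t => F (θ t)) (Set.uIcc X Y) := hFc.comp_continuousOn hθc
  have hsub' : ∫ t in X..Y, (F ∘ θ) t * (-h * κ t) = -h * ∫ t in X..Y, F (θ t) * κ t := by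
    rw [← intervalIntegral.integral_const_mul]
    congr 1
    ext t
    simp only [Function.comp]
    ring
  have hbound : |∫ u in θ X..θ Y, F u| ≤ (|h| / (c * X ^ γ) + 1) * Z := by
    have hθX : |θ X| = |h| / (c * X ^ γ) := by
      simp only [hθ]
      rw [abs_div, abs_of_pos (by positivity : 0 < c * X ^ γ)]
    have hdiff : |θ Y - θ X| ≤ |θ X| := by
      have hXγ : X ^ γ ≤ Y ^ γ := Real.rpow_le_rpow hX.le hXY hγ0.le
      have hXp : 0 < X ^ γ := by positivity
      have e : θ Y - θ X = -(θ X * (1 - X ^ γ / Y ^ γ)) := by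
        simp only [hθ]
        have : 0 < Y ^ γ := by positivity
        field_simp
        ring
      rw [e, abs_neg, abs_mul]
      refine mul_le_of_le_one_right (abs_nonneg _) ?_
      have h1 : X ^ γ / Y ^ γ ≤ 1 := by
        rw [div_le_one (by positivity)]
        exact hXγ
      have h2 : 0 ≤ X ^ γ / Y ^ γ := by positivity
      rw [abs_le]
      constructor <;> linarith
    rw [← hθX]
    have key : ∀ x y, x ≤ y → |∫ u in x..y, F u| ≤ (|y - x| + 1) * Z := fun x y hxy => by
      rw [abs_of_nonneg (intervalIntegral.integral_nonneg hxy fun u _ => sq_nonneg _),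
        abs_of_nonneg (sub_nonneg.2 hxy)]
      exact integral_norm_sq_trigSum_le hφ Z hxy
    refine le_trans (b := (|θ Y - θ X| + 1) * Z) ?_ (by gcongr)
    rcases le_total (θ X) (θ Y) with h1 | h1
    · exact key _ _ h1
    · rw [intervalIntegral.integral_symm, abs_neg, abs_sub_comm]
      exact key _ _ h1
  have hmono : κ Y * ∫ t in X..Y, F (θ t) ≤ ∫ t in X..Y, F (θ t) * κ t := by
    rw [← intervalIntegral.integral_const_mul]
    refine intervalIntegral.integral_mono_on hXY
      (continuousOn_const.mul hFθ).intervalIntegrable (hFθ.mul hκc).intervalIntegrable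
      fun t ht => ?_
    rw [mul_comm]
    refine mul_le_mul_of_nonneg_left ?_ (sq_nonneg _)
    refine mul_le_mul_of_nonneg_left ?_ (by positivity)
    exact Real.rpow_le_rpow_of_nonpos (hX.trans_le ht.1) ht.2 (by linarith)
  have h0 : 0 ≤ ∫ t in X..Y, F (θ t) * κ t := by
    refine intervalIntegral.integral_nonneg hXY fun t ht => ?_
    have := hX.trans_le ht.1
    exact mul_nonneg (sq_nonneg _) (by positivity)
  have hfin : |h| * (κ Y * ∫ t in X..Y, F (θ t)) ≤ (|h| / (c * X ^ γ) + 1) * Z := by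
    refine le_trans ?_ hbound
    rw [← hsub, hsub', abs_mul, abs_neg, abs_of_nonneg h0]
    gcongr
  have hκY : κ Y = γ / (c * Y ^ (γ + 1)) := by
    simp only [hκ]
    rw [← neg_add', Real.rpow_neg hY.le]
    field_simp
  have hh' : 0 < |h| := abs_pos.2 hh
  have hYp : 0 < Y ^ (γ + 1) := by positivity
  rw [hκY] at hfin
  calc ∫ t in X..Y, F (θ t) = c * Y ^ (γ + 1) / (|h| * γ) *
        (|h| * (γ / (c * Y ^ (γ + 1)) * ∫ t in X..Y, F (θ t))) := by field_simp
    _ ≤ c * Y ^ (γ + 1) / (|h| * γ) * ((|h| / (c * X ^ γ) + 1) * Z) := by gcongr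
    _ = _ := by ring

theorem integral_le_sqrt_mul_sqrt {f : ℝ → ℝ} {a b : ℝ} (hab : a ≤ b)
    (hf : ContinuousOn f (Set.uIcc a b)) :
    ∫ t in a..b, f t ≤ √((b - a) * ∫ t in a..b, f t ^ 2) := by
  refine Real.le_sqrt_of_sq_le ?_
  set I := ∫ t in a..b, f t
  rcases eq_or_lt_of_le hab with h | h
  · simp [I, h]
  have h1 : 0 ≤ ∫ t in a..b, (f t - I / (b - a)) ^ 2 :=
    intervalIntegral.integral_nonneg hab fun t _ => sq_nonneg _
  have i1 : IntervalIntegrable (fun t => f t ^ 2) MeasureTheory.volume a b :=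
    (hf.pow 2).intervalIntegrable
  have i2 : IntervalIntegrable (fun t => 2 * (I / (b - a)) * f t) MeasureTheory.volume a b :=
    (continuousOn_const.mul hf).intervalIntegrable
  have h2 : ∫ t in a..b, (f t - I / (b - a)) ^ 2 =
      (∫ t in a..b, f t ^ 2) - 2 * (I / (b - a)) * I + (b - a) * (I / (b - a)) ^ 2 := by
    have : (fun t => (f t - I / (b - a)) ^ 2) =
        fun t => (f t ^ 2 - 2 * (I / (b - a)) * f t) + (I / (b - a)) ^ 2 := by
      ext t; ring
    rw [this, intervalIntegral.integral_add (i1.sub i2) (by simp),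
      intervalIntegral.integral_sub i1 i2, intervalIntegral.integral_const_mul]
    simp [I]
  rw [h2] at h1
  have hba : 0 < b - a := by linarith
  have h3 : 2 * (I / (b - a)) * I - (b - a) * (I / (b - a)) ^ 2 = I ^ 2 / (b - a) := by
    field_simp
    ring
  have h4 : I ^ 2 / (b - a) ≤ ∫ t in a..b, f t ^ 2 := by linarith
  rw [div_le_iff₀ hba] at h4
  linarith

end MeanValue

section LongSums

variable {φ : ℕ → ℂ} {c X Y : ℝ}

theorem continuousOn_trigSum_div (φ : ℕ → ℂ) (Z : ℕ) (h : ℝ) (hc : 0 < c) (γ : ℝ) :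
    ContinuousOn (fun t : ℝ => ‖trigSum φ Z (h / (c * t ^ γ))‖) (Set.Ioi 0) := by
  refine ((continuous_trigSum φ Z).norm.comp_continuousOn ?_)
  refine continuousOn_const.div (continuousOn_const.mul
    (continuousOn_id.rpow_const fun t ht => Or.inl (ne_of_gt ht))) fun t ht => ?_
  have : (0 : ℝ) < t ^ γ := Real.rpow_pos_of_pos ht γ
  positivity

theorem continuousOn_fejerMean (φ : ℕ → ℂ) (Z H : ℕ) (hc : 0 < c) (γ : ℝ) :
    ContinuousOn (fun t : ℝ => fejerMean φ Z H (c * t ^ γ)) (Set.Ioi 0) := by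
  unfold fejerMean
  refine continuousOn_const.mul ?_
  refine continuousOn_finsetSum _ fun j _ => continuousOn_finsetSum _ fun l _ => ?_
  exact continuousOn_trigSum_div φ Z _ hc γ

theorem fejerMean_nonneg (φ : ℕ → ℂ) (Z H : ℕ) (α : ℝ) : 0 ≤ fejerMean φ Z H α := by
  unfold fejerMean
  positivity

theorem integral_fejerMean_le (hφ : ∀ v, ‖φ v‖ ≤ 1) (hc : 1 < c) (hX : 0 < X) (hXY : X ≤ Y)
    (Z : ℕ) {H : ℕ} (hH : H ≠ 0) :
    ∫ t in X..Y, fejerMean φ Z H (c * t ^ (1 - 1 / c)) ≤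
      Y * ‖∑ v ∈ Finset.range Z, φ v‖ +
      4 * √(Y * (c * Y ^ (2 - 1 / c) / (1 - 1 / c) * (H / (c * X ^ (1 - 1 / c)) + 1) * Z) * H) := by
  have hc0 : 0 < c := by linarith
  have hγ0 : 0 < 1 - 1 / c := by
    rw [sub_pos, div_lt_one hc0]
    exact hc
  have hY : 0 < Y := hX.trans_le hXY
  set Q := c * Y ^ (2 - 1 / c) / (1 - 1 / c) * (H / (c * X ^ (1 - 1 / c)) + 1) * Z with hQ
  have hQ0 : 0 ≤ Q := by positivity
  have hsub : Set.uIcc X Y ⊆ Set.Ioi 0 := by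
    rw [Set.uIcc_of_le hXY]
    exact fun t ht => hX.trans_le ht.1
  have hcont : ∀ h : ℝ, ContinuousOn
      (fun t : ℝ => ‖trigSum φ Z (h / (c * t ^ (1 - 1 / c)))‖) (Set.uIcc X Y) := fun h =>
    (continuousOn_trigSum_div φ Z h hc0 _).mono hsub
  have hterm : ∀ j ∈ Finset.range H, ∀ l ∈ Finset.range H,
      ∫ t in X..Y, ‖trigSum φ Z (((j : ℤ) - l : ℤ) / (c * t ^ (1 - 1 / c)))‖ ≤
        (if j = l then Y * ‖∑ v ∈ Finset.range Z, φ v‖ else 0) +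
          √(Y * Q) * (√|(((j : ℤ) - l : ℤ) : ℝ)|)⁻¹ := by
    intro j hj l hl
    split_ifs with hjl
    · subst hjl
      simp only [sub_self, Int.cast_zero, zero_div, trigSum_zero, intervalIntegral.integral_const,
        smul_eq_mul, abs_zero, Real.sqrt_zero, inv_zero, mul_zero, add_zero]
      gcongr
      linarith
    · rw [zero_add]
      set h : ℝ := (((j : ℤ) - l : ℤ) : ℝ) with hh
      have hh0 : h ≠ 0 := by
        rw [hh]
        exact Int.cast_ne_zero.2 (by omega)
      have hhH : |h| ≤ H := by
        have h1 := Finset.mem_range.1 hj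
        have h2 := Finset.mem_range.1 hl
        rw [hh, ← Int.cast_abs]
        have : |(j : ℤ) - l| ≤ H := abs_le.2 ⟨by omega, by omega⟩
        exact_mod_cast this
      have hh' : 0 < |h| := abs_pos.2 hh0
      refine (integral_le_sqrt_mul_sqrt hXY (hcont h)).trans ?_
      rw [← Real.sqrt_inv, ← Real.sqrt_mul (by positivity)]
      refine Real.sqrt_le_sqrt ?_
      rw [mul_assoc]
      have h1 := integral_norm_sq_trigSum_comp_le hφ hc hX hXY Z hh0
      have h2 : c * Y ^ (2 - 1 / c) / (|h| * (1 - 1 / c)) *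
          (|h| / (c * X ^ (1 - 1 / c)) + 1) * Z ≤ Q * |h|⁻¹ := by
        calc c * Y ^ (2 - 1 / c) / (|h| * (1 - 1 / c)) * (|h| / (c * X ^ (1 - 1 / c)) + 1) * Z
            ≤ c * Y ^ (2 - 1 / c) / (|h| * (1 - 1 / c)) *
                (H / (c * X ^ (1 - 1 / c)) + 1) * Z := by gcongr
          _ = Q * |h|⁻¹ := by
              rw [hQ]
              field_simp
      have h3 : 0 ≤ ∫ t in X..Y, ‖trigSum φ Z (h / (c * t ^ (1 - 1 / c)))‖ ^ 2 :=
        intervalIntegral.integral_nonneg hXY fun t _ => sq_nonneg _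
      exact mul_le_mul (by linarith) (h1.trans h2) h3 hY.le
  have hint : ∀ h : ℝ, IntervalIntegrable
      (fun t : ℝ => ‖trigSum φ Z (h / (c * t ^ (1 - 1 / c)))‖) MeasureTheory.volume X Y := fun h =>
    (hcont h).intervalIntegrable
  have hHpos : (0 : ℝ) < H := by exact_mod_cast Nat.pos_of_ne_zero hH
  unfold fejerMean
  rw [intervalIntegral.integral_const_mul, intervalIntegral.integral_finsetSum
    fun j _ => (continuousOn_finsetSum _ fun l _ => hcont _).intervalIntegrable]
  rw [inv_mul_le_iff₀ hHpos]
  calc ∑ j ∈ Finset.range H, ∫ t in X..Y, ∑ l ∈ Finset.range H,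
        ‖trigSum φ Z (((j : ℤ) - l : ℤ) / (c * t ^ (1 - 1 / c)))‖
      ≤ ∑ j ∈ Finset.range H, (Y * ‖∑ v ∈ Finset.range Z, φ v‖ + √(Y * Q) * (4 * √H)) := by
        refine Finset.sum_le_sum fun j hj => ?_
        rw [intervalIntegral.integral_finsetSum fun l _ => hint _]
        refine (Finset.sum_le_sum (hterm j hj)).trans ?_
        rw [Finset.sum_add_distrib, ← Finset.mul_sum, Finset.sum_ite_eq, if_pos hj]
        gcongr
        exact sum_inv_sqrt_abs_sub_le (Finset.mem_range.1 hj)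
    _ = _ := by
        rw [Finset.sum_const, Finset.card_range, nsmul_eq_mul, Real.sqrt_mul (by positivity) (H : ℝ)]
        ring

theorem card_filter_rpow_mem_le (hc : 1 ≤ c) (S : Finset ℕ) (w : ℝ) {z : ℝ} (hz : 0 ≤ z)
    (hS : ∀ n ∈ S, w < (n : ℝ) ^ c ∧ (n : ℝ) ^ c < w + z) : (S.card : ℝ) ≤ z ^ (1 / c) + 1 := by
  have hc0 : 0 < c := by linarith
  set u := max w 0 with hu
  have hu0 : 0 ≤ u := le_max_right _ _
  have hinv : ∀ n : ℕ, ((n : ℝ) ^ c) ^ (1 / c) = n := fun n => by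
    rw [← Real.rpow_mul (Nat.cast_nonneg n), mul_one_div_cancel hc0.ne', Real.rpow_one]
  have hz' : 0 ≤ z ^ (1 / c) := by positivity
  refine (card_le_of_forall_mem_Icc (a := u ^ (1 / c)) (b := u ^ (1 / c) + z ^ (1 / c))
    (by linarith) fun n hn => ?_).trans (by linarith)
  obtain ⟨h1, h2⟩ := hS n hn
  have hn0 : (0 : ℝ) ≤ (n : ℝ) ^ c := by positivity
  constructor
  · calc u ^ (1 / c) ≤ ((n : ℝ) ^ c) ^ (1 / c) :=
          Real.rpow_le_rpow hu0 (max_le h1.le hn0) (by positivity)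
      _ = n := hinv n
  · calc (n : ℝ) = ((n : ℝ) ^ c) ^ (1 / c) := (hinv n).symm
      _ ≤ (u + z) ^ (1 / c) :=
          Real.rpow_le_rpow hn0 (h2.le.trans (by linarith [le_max_left w 0])) (by positivity)
      _ ≤ _ := Real.rpow_add_le_add_rpow hu0 hz (by positivity)
          (by rw [div_le_one hc0]; exact hc)

variable {L : ℝ} {T : ℝ → ℝ}

theorem norm_sum_blockFun_le_card (hφ : ∀ v, ‖φ v‖ ≤ 1) (hT : IsBump L T) (M Z : ℕ) (w : ℝ) :
    ‖∑ n ∈ Finset.range M, blockFun φ T Z ((n : ℝ) ^ c - w)‖ ≤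
      ((Finset.range M).filter fun n : ℕ => w < (n : ℝ) ^ c ∧ (n : ℝ) ^ c < w + Z).card := by
  refine (norm_sum_le _ _).trans ?_
  rw [Finset.card_filter]
  push_cast
  refine Finset.sum_le_sum fun n _ => ?_
  split_ifs with h
  · exact norm_blockFun_le hφ hT _ _
  · rw [not_and_or, not_lt, not_lt] at h
    rcases h with h | h
    · rw [blockFun_eq_zero_of_nonpos hT _ (by linarith), norm_zero]
    · rw [blockFun_eq_zero_of_le hT (by linarith), norm_zero]

end LongSums

section LongSumBound

variable {ω : ℂ} {φ : ℕ → ℂ} {L : ℝ} {T : ℝ → ℝ}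

theorem norm_sum_blockFun_le_of_integral_le (h : FibMultiplicative ω φ) (hT : IsBump L T)
    {c s₁ K Y E I : ℝ} {r H M : ℕ} (hc : 1 < c) (hc2 : c < 2) (hs₁ : 1 ≤ s₁) (hr : 1 ≤ r)
    (hK : K ≤ s₁) (hV : Nat.fib (r + 1) ≤ K * (c * s₁ ^ (c - 1))) (hXY : s₁ ^ c ≤ Y)
    (hH : H ≠ 0) (hM : Y ^ (1 / c) + K + 1 ≤ M)
    (hE : (2 * K + 1) * (2 * L * ((c - 1) * K ^ 2 * s₁ ^ (c - 2))) +
      (2 * K + 2) * (2 * L * (c * Y ^ (1 - 1 / c)) * (Real.log (1 + H ^ 2) / (2 * H))) ≤ E)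
    (hI : ∀ k, r ≤ k → k ≤ r + 1 →
      ∫ t in (s₁ ^ c)..Y, fejerMean φ (Nat.fib k) H (c * t ^ (1 - 1 / c)) ≤ I)
    (Z : ℕ) (w : ℝ) (hwY : w + Z ≤ Y) :
    ‖∑ n ∈ Finset.range M, blockFun φ T Z ((n : ℝ) ^ c - w)‖ ≤
      5 * s₁ + 2 + (Nat.fib r : ℝ)⁻¹ * (Y * E + (∫ u, T u) / (c * s₁ ^ (c - 1)) * (2 * I)) := by
  have hL := hT.lipschitz_nonneg
  have hφ := h.norm_le
  have hc0 : 0 < c := by linarith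
  have hs0 : 0 < s₁ := by linarith
  have hα₁ : 0 < c * s₁ ^ (c - 1) := by positivity
  have hK0 : 0 ≤ K := nonneg_of_mul_nonneg_left ((Nat.cast_nonneg _).trans hV) hα₁
  have hμ : 0 ≤ ∫ u, T u := MeasureTheory.integral_nonneg hT.nonneg
  have hlog : 0 ≤ Real.log (1 + (H : ℝ) ^ 2) := Real.log_nonneg (by nlinarith)
  set X := s₁ ^ c with hX_def
  have hX : 0 < X := by positivity
  have hY : 0 < Y := hX.trans_le hXY
  have hVX : (Nat.fib (r + 1) : ℝ) ≤ 2 * X := by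
    have h1 : s₁ * s₁ ^ (c - 1) = X := by
      rw [mul_comm, ← Real.rpow_add_one hs0.ne', sub_add_cancel]
    calc (Nat.fib (r + 1) : ℝ) ≤ s₁ * (2 * s₁ ^ (c - 1)) := hV.trans (by gcongr)
      _ = 2 * X := by rw [← h1]; ring
  have hfr : (0 : ℝ) < Nat.fib r := by exact_mod_cast Nat.fib_pos.2 (by omega)
  have hfmono : ∀ k, r ≤ k → (Nat.fib r : ℝ) ≤ Nat.fib k := fun k hk => by
    exact_mod_cast Nat.fib_mono hk
  have hfmono' : ∀ k, k ≤ r + 1 → (Nat.fib k : ℝ) ≤ Nat.fib (r + 1) := fun k hk => by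
    exact_mod_cast Nat.fib_mono hk
  have hE0 : 0 ≤ E := le_trans (by have : 0 ≤ c - 1 := by linarith
                                   positivity) hE
  set P : ℕ → ℝ → ℝ := fun k t => fejerMean φ (Nat.fib k) H (c * t ^ (1 - 1 / c)) with hP
  have hP0 : ∀ k t, 0 ≤ P k t := fun k t => fejerMean_nonneg _ _ _ _
  have hPc : ∀ k, ContinuousOn (P k) (Set.Ioi 0) := fun k => continuousOn_fejerMean _ _ _ hc0 _
  set A : ℝ → ℝ := fun t => E + (∫ u, T u) / (c * s₁ ^ (c - 1)) * (P r t + P (r + 1) t) with hA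
  have hA0 : ∀ t, 0 ≤ A t := fun t => by
    have := hP0 r t
    have := hP0 (r + 1) t
    positivity
  have hAc : ContinuousOn A (Set.Ioi 0) :=
    continuousOn_const.add (continuousOn_const.mul ((hPc r).add (hPc (r + 1))))
  have hAi : ∀ a b, X ≤ a → X ≤ b → IntervalIntegrable A MeasureTheory.volume a b :=
    fun a b ha hb => (hAc.mono fun t ht =>
      hX.trans_le ((le_min ha hb).trans ht.1)).intervalIntegrable
  set S : ℝ → Finset ℕ := fun y =>
    (Finset.range M).filter fun n : ℕ => (n : ℝ) ^ c < y ∧ (n : ℝ) ^ c < 3 * X with hS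
  have hSmono : ∀ y y', y ≤ y' → S y ⊆ S y' := fun y y' hy n hn => by
    simp only [hS, Finset.mem_filter] at hn ⊢
    exact ⟨hn.1, hn.2.1.trans_le hy, hn.2.2⟩
  set J : ℝ → ℝ := fun y => (Nat.fib r : ℝ)⁻¹ * ∫ t in X..(max y X), A t with hJ
  have hJmono : Monotone J := fun y y' hy => by
    refine mul_le_mul_of_nonneg_left ?_ (by positivity)
    have hle : max y X ≤ max y' X := max_le_max_right X hy
    rw [← sub_nonneg, intervalIntegral.integral_interval_sub_left
      (hAi _ _ le_rfl (le_max_right _ _)) (hAi _ _ le_rfl (le_max_right _ _))]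
    exact intervalIntegral.integral_nonneg hle fun t _ => hA0 t
  set R : ℝ → ℝ := fun y => (S y).card + J y with hR
  have hRmono : Monotone R := fun y y' hy => by
    have h1 : ((S y).card : ℝ) ≤ (S y').card := by
      exact_mod_cast Finset.card_le_card (hSmono y y' hy)
    exact add_le_add h1 (hJmono hy)
  have hblock : ∀ k, k = r ∨ k = r + 1 → ∀ w t, X ≤ w → w ≤ t → t ≤ w + Nat.fib k →
      w + Nat.fib k ≤ Y →
      ‖∑ n ∈ Finset.range M, blockFun φ T (Nat.fib k) ((n : ℝ) ^ c - w)‖ ≤ A t := by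
    intro k hk w t hw hwt htk hY'
    have ht0 : 0 < t := by linarith
    have htc : (t ^ (1 / c)) ^ c = t := by
      rw [← Real.rpow_mul ht0.le, one_div_mul_cancel hc0.ne', Real.rpow_one]
    have htα : (t ^ (1 / c)) ^ (c - 1) = t ^ (1 - 1 / c) := by
      rw [← Real.rpow_mul ht0.le]
      congr 1
      field_simp
    have hγ : 0 < 1 - 1 / c := by
      rw [sub_pos, div_lt_one hc0]
      exact hc
    have htY : t ≤ Y := htk.trans hY'
    have h1 := norm_sum_blockFun_le (K := K) (Z := Nat.fib k) (H := H) (M := M)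
      (σ := t ^ (1 / c)) hφ hT hc hc2 hs₁ hw
      ((hfmono' k (by omega)).trans hV) hK (by positivity) (by rw [htc]; exact hwt)
      (by rw [htc]; exact htk) hH (by
        have := Real.rpow_le_rpow ht0.le htY (by positivity : 0 ≤ 1 / c)
        linarith)
    rw [htα] at h1
    have h2 : t ^ (1 - 1 / c) ≤ Y ^ (1 - 1 / c) := Real.rpow_le_rpow ht0.le htY hγ.le
    have h3 : s₁ ^ (c - 1) ≤ t ^ (1 - 1 / c) := by
      rw [← htα]
      refine Real.rpow_le_rpow hs0.le ?_ (by linarith)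
      rw [← Real.rpow_le_rpow_iff hs0.le (by positivity) hc0, htc]
      linarith
    have h4 : P k t ≤ P r t + P (r + 1) t := by
      have := hP0 r t
      have := hP0 (r + 1) t
      rcases hk with rfl | rfl <;> linarith
    have h5 : (2 * K + 2) * (2 * L * (c * t ^ (1 - 1 / c)) * (Real.log (1 + H ^ 2) / (2 * H))) ≤
        (2 * K + 2) * (2 * L * (c * Y ^ (1 - 1 / c)) * (Real.log (1 + H ^ 2) / (2 * H))) := by
      gcongr
    have h6 : (∫ u, T u) / (c * t ^ (1 - 1 / c)) * P k t ≤
        (∫ u, T u) / (c * s₁ ^ (c - 1)) * (P r t + P (r + 1) t) := by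
      have := hP0 k t
      gcongr
    exact h1.trans (by simp only [hA]; linarith)
  have hbase : ∀ k, r ≤ k → k ≤ r + 1 → ∀ w', w ≤ w' → w' + Nat.fib k ≤ Y →
      ‖∑ n ∈ Finset.range M, blockFun φ T (Nat.fib k) ((n : ℝ) ^ c - w')‖ ≤
        R (w' + Nat.fib k) - R w' := by
    intro k hk1 hk2 w' _ hY'
    have hfk : (0 : ℝ) ≤ Nat.fib k := Nat.cast_nonneg _
    rcases lt_or_ge w' X with hwX | hwX
    · refine (norm_sum_blockFun_le_card hφ hT M _ w').trans ?_
      have h1 := hJmono (show w' ≤ w' + Nat.fib k by linarith)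
      have h2 := hfmono' k hk2
      have h3 : ((Finset.range M).filter fun n : ℕ =>
          w' < (n : ℝ) ^ c ∧ (n : ℝ) ^ c < w' + Nat.fib k) ∪ S w' ⊆ S (w' + Nat.fib k) := by
        refine Finset.union_subset (fun n hn => ?_) (hSmono _ _ (by linarith))
        simp only [hS, Finset.mem_filter] at hn ⊢
        exact ⟨hn.1, hn.2.2, by linarith⟩
      have h4 : Disjoint ((Finset.range M).filter fun n : ℕ =>
          w' < (n : ℝ) ^ c ∧ (n : ℝ) ^ c < w' + Nat.fib k) (S w') := by
        rw [Finset.disjoint_left]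
        intro n hn hn'
        simp only [hS, Finset.mem_filter] at hn hn'
        linarith [hn.2.1, hn'.2.1]
      have h5 := Finset.card_le_card h3
      rw [Finset.card_union_of_disjoint h4] at h5
      have h6 : ((((Finset.range M).filter fun n : ℕ =>
          w' < (n : ℝ) ^ c ∧ (n : ℝ) ^ c < w' + Nat.fib k).card : ℕ) : ℝ) + (S w').card ≤
          (S (w' + Nat.fib k)).card := by exact_mod_cast h5
      simp only [hR]
      linarith
    · have h1 : ((S w').card : ℝ) ≤ (S (w' + Nat.fib k)).card := by
        exact_mod_cast Finset.card_le_card (hSmono _ _ (by linarith))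
      have h2 : J (w' + Nat.fib k) - J w' =
          (Nat.fib r : ℝ)⁻¹ * ∫ t in w'..(w' + Nat.fib k), A t := by
        simp only [hJ]
        rw [← mul_sub, max_eq_left hwX, max_eq_left (by linarith),
          intervalIntegral.integral_interval_sub_left (hAi _ _ le_rfl (by linarith))
            (hAi _ _ le_rfl hwX)]
      set N := ‖∑ n ∈ Finset.range M, blockFun φ T (Nat.fib k) ((n : ℝ) ^ c - w')‖ with hN
      have h3 : Nat.fib k * N ≤ ∫ t in w'..(w' + Nat.fib k), A t := by
        have := intervalIntegral.integral_mono_on (μ := MeasureTheory.volume)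
          (f := fun _ => N) (g := A) (a := w') (b := w' + Nat.fib k) (by linarith) (by simp)
          (hAi _ _ hwX (by linarith)) fun t ht =>
            hblock k (by omega) w' t hwX ht.1 ht.2 hY'
        simpa using this
      have h4 : N ≤ (Nat.fib r : ℝ)⁻¹ * ∫ t in w'..(w' + Nat.fib k), A t := by
        rw [le_inv_mul_iff₀ hfr]
        refine le_trans ?_ h3
        exact mul_le_mul_of_nonneg_right (hfmono k hk1) (norm_nonneg _)
      simp only [hR]
      linarith
  have hsX : X ^ (1 / c) = s₁ := by
    rw [hX_def, ← Real.rpow_mul hs0.le, mul_one_div_cancel hc0.ne', Real.rpow_one]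
  have hpow : ∀ C : ℝ, 1 ≤ C → (C * X) ^ (1 / c) ≤ C * s₁ := fun C hC => by
    rw [Real.mul_rpow (by linarith) hX.le, hsX]
    have : C ^ (1 / c) ≤ C := by
      calc C ^ (1 / c) ≤ C ^ (1 : ℝ) :=
            Real.rpow_le_rpow_of_exponent_le hC (by rw [div_le_one hc0]; exact hc.le)
        _ = C := Real.rpow_one C
    gcongr
  have hB : ∀ z, z < Nat.fib (r + 1) → ∀ w', w ≤ w' → w' + z ≤ Y →
      ‖∑ n ∈ Finset.range M, blockFun φ T z ((n : ℝ) ^ c - w')‖ ≤ 2 * s₁ + 1 := by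
    intro z hz w' _ _
    refine (norm_sum_blockFun_le_card hφ hT M z w').trans ?_
    refine (card_filter_rpow_mem_le hc.le _ w' (Nat.cast_nonneg z) fun n hn =>
      (Finset.mem_filter.1 hn).2).trans ?_
    have h1 : (z : ℝ) ≤ 2 * X := le_trans (by exact_mod_cast hz.le) hVX
    have h2 := Real.rpow_le_rpow (Nat.cast_nonneg z) h1 (by positivity : 0 ≤ 1 / c)
    linarith [hpow 2 (by norm_num)]
  have hrec := norm_le_of_recurrence
    (D := fun Z w => ∑ n ∈ Finset.range M, blockFun φ T Z ((n : ℝ) ^ c - w)) h.norm_const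
    (fun k z hz w => by
      rw [Finset.mul_sum, ← Finset.sum_add_distrib]
      refine Finset.sum_congr rfl fun n _ => ?_
      rw [h.blockFun_add hz, sub_sub]) hbase hRmono hB Z w le_rfl hwY
  have hSY : ((S (w + Z)).card : ℝ) ≤ 3 * s₁ + 1 := by
    refine (card_le_of_forall_mem_Icc (a := 0) (b := 3 * s₁) (by linarith) fun n hn => ?_).trans
      (by linarith)
    refine ⟨Nat.cast_nonneg n, le_trans ?_ (hpow 3 (by norm_num))⟩
    have h1 := (Finset.mem_filter.1 hn).2.2
    have h2 : ((n : ℝ) ^ c) ^ (1 / c) = n := by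
      rw [← Real.rpow_mul (Nat.cast_nonneg n), mul_one_div_cancel hc0.ne', Real.rpow_one]
    rw [← h2]
    exact Real.rpow_le_rpow (by positivity) h1.le (by positivity)
  have hRw : 0 ≤ R w := by
    refine add_nonneg (Nat.cast_nonneg _) (mul_nonneg (by positivity) ?_)
    exact intervalIntegral.integral_nonneg (le_max_right _ _) fun t _ => hA0 t
  have hPi : ∀ k, IntervalIntegrable (P k) MeasureTheory.volume X Y := fun k =>
    ((hPc k).mono fun t ht => by
      rw [Set.uIcc_of_le hXY] at ht
      exact hX.trans_le ht.1).intervalIntegrable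
  have hJY : J (w + Z) ≤
      (Nat.fib r : ℝ)⁻¹ * (Y * E + (∫ u, T u) / (c * s₁ ^ (c - 1)) * (2 * I)) := by
    refine (hJmono hwY).trans ?_
    simp only [hJ]
    rw [max_eq_left hXY]
    refine mul_le_mul_of_nonneg_left ?_ (by positivity)
    simp only [hA]
    rw [intervalIntegral.integral_add (by simp) (((hPi r).add (hPi (r + 1))).const_mul _),
      intervalIntegral.integral_const_mul, intervalIntegral.integral_add (hPi r) (hPi (r + 1)),
      intervalIntegral.integral_const, smul_eq_mul]
    have h1 := hI r le_rfl (by omega)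
    have h2 := hI (r + 1) (by omega) le_rfl
    gcongr
    · linarith
    · linarith
  simp only [hR] at hrec
  simp only [hR] at hRw
  linarith

end LongSumBound

section Parameters

theorem IsBump.integral_le {L : ℝ} {T : ℝ → ℝ} (hT : IsBump L T) {a b : ℝ} (hab : a ≤ b)
    (hs : ∀ u, u ≤ a ∨ b < u → T u = 0) : ∫ u, T u ≤ b - a := by
  have h1 : ∫ u, T u = ∫ u in a..b, T u := by
    rw [intervalIntegral.integral_of_le hab]
    refine (MeasureTheory.setIntegral_eq_integral_of_forall_compl_eq_zero fun u hu => ?_).symm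
    rw [Set.mem_Ioc, not_and_or, not_lt, not_le] at hu
    exact hs u hu
  have h2 : ∫ u in a..b, T u ≤ ∫ _ in a..b, (1 : ℝ) :=
    intervalIntegral.integral_mono_on hab (hT.continuous.intervalIntegrable _ _) (by simp)
      fun u _ => hT.le_one u
  rw [h1]
  simpa using h2

theorem IsBump.integral_le_one {L : ℝ} {T : ℝ → ℝ} (hT : IsBump L T) : ∫ u, T u ≤ 1 := by
  have := hT.integral_le (zero_le_one' ℝ) fun u hu => hu.elim (hT.eq_zero_of_nonpos u)
    fun h => hT.eq_zero_of_one_le u h.le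
  simpa using this

theorem exists_fib_mem_Icc {V : ℝ} (hV : 1 ≤ V) :
    ∃ r, 1 ≤ r ∧ (Nat.fib (r + 1) : ℝ) ≤ V ∧ V ≤ 4 * Nat.fib r := by
  have h1 : 1 ≤ ⌊V⌋₊ := Nat.le_floor (by simpa using hV)
  have h2 : 2 ≤ Nat.greatestFib ⌊V⌋₊ := Nat.le_greatestFib.2 (by simpa using h1)
  obtain ⟨r, hr⟩ : ∃ r, Nat.greatestFib ⌊V⌋₊ = r + 1 := ⟨Nat.greatestFib ⌊V⌋₊ - 1, by omega⟩
  have h3 := Nat.fib_greatestFib_le ⌊V⌋₊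
  have h4 := Nat.lt_fib_greatestFib_add_one ⌊V⌋₊
  rw [hr] at h2 h3 h4
  obtain ⟨s, rfl⟩ : ∃ s, r = s + 1 := ⟨r - 1, by omega⟩
  refine ⟨s + 1, by omega, (Nat.le_floor_iff (by linarith)).1 h3, ?_⟩
  have h5 : ⌊V⌋₊ + 1 ≤ 4 * Nat.fib (s + 1) := by
    have e1 : Nat.fib (s + 3) = Nat.fib (s + 1) + Nat.fib (s + 2) := Nat.fib_add_two
    have e2 : Nat.fib (s + 2) = Nat.fib s + Nat.fib (s + 1) := Nat.fib_add_two
    have e3 : Nat.fib s ≤ Nat.fib (s + 1) := Nat.fib_le_fib_succ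
    have e4 : Nat.fib (s + 1 + 1 + 1) = Nat.fib (s + 3) := rfl
    omega
  have h6 : ((⌊V⌋₊ + 1 : ℕ) : ℝ) ≤ ((4 * Nat.fib (s + 1) : ℕ) : ℝ) := by exact_mod_cast h5
  push_cast at h6
  linarith [Nat.lt_floor_add_one V]

set_option maxHeartbeats 1000000 in
theorem exists_norm_sum_blockFun_le {c ε : ℝ} (hc : 1 < c) (hc' : c < 4 / 3) (hε : 0 < ε)
    (hε' : ε ≤ (1 - 3 / 4 * c) / 6) :
    ∃ C : ℝ, 0 ≤ C ∧ ∀ (x G : ℝ) (ω : ℂ) (φ : ℕ → ℂ) (T : ℝ → ℝ), 1 ≤ x →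
      FibMultiplicative ω φ → IsBump (x ^ ε) T →
      (∀ k, x ^ (c / 2 - 2 * ε) ≤ 4 * Nat.fib k →
        (∫ u, T u) * ‖∑ v ∈ Finset.range (Nat.fib k), φ v‖ ≤ G * Nat.fib k) →
      ∀ (Z M : ℕ) (w : ℝ), w + Z ≤ 3 * x ^ c → 4 * x + 1 ≤ M →
        ‖∑ n ∈ Finset.range M, blockFun φ T Z ((n : ℝ) ^ c - w)‖ ≤
          C * (x ^ (1 - ε) + x ^ (1 + (c - 1) * ε) * G) := by
  have hc0 : 0 < c := by linarith
  have hγ : 0 < 1 - 1 / c := by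
    rw [sub_pos, div_lt_one hc0]
    exact hc
  obtain ⟨q, hq⟩ : ∃ y : ℝ, y = 3 * (c * 9 / (1 - 1 / c) * 3) * 2 := ⟨_, rfl⟩
  have hq0 : 0 ≤ q := by rw [hq]; positivity
  obtain ⟨C, hC⟩ : ∃ y : ℝ, y = 7 + 72 + 12 * (24 * (40 / ε)) + 32 * √q + 48 := ⟨_, rfl⟩
  refine ⟨C, by rw [hC]; positivity, ?_⟩
  obtain ⟨v, hv⟩ : ∃ y : ℝ, y = c / 2 - 2 * ε := ⟨_, rfl⟩
  obtain ⟨k₀, hk₀⟩ : ∃ y : ℝ, y = 1 - c / 2 - (3 - c) * ε := ⟨_, rfl⟩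
  obtain ⟨b, hb⟩ : ∃ y : ℝ, y = (1 - ε) * (c - 1) := ⟨_, rfl⟩
  obtain ⟨h₀, hh₀⟩ : ∃ y : ℝ, y = c - 1 + 3 * ε := ⟨_, rfl⟩
  have hv0 : 0 ≤ v := by rw [hv]; linarith
  have hk₀0 : 0 ≤ k₀ := by rw [hk₀]; nlinarith
  have hh₀0 : 0 ≤ h₀ := by rw [hh₀]; linarith
  have hks : k₀ ≤ 1 - ε := by rw [hk₀]; nlinarith
  have hhb : 0 ≤ h₀ - b := by rw [hh₀, hb]; nlinarith
  have hcε : (1 - ε) * c ≤ c := by nlinarith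
  have hexp₁ : -v + c + (3 * k₀ + ε + (1 - ε) * (c - 2)) ≤ 1 - ε := by
    rw [hv, hk₀]
    nlinarith
  have hexp₂ : -v + c + (k₀ + ε + (c - 1) + ε / 2 - h₀) ≤ 1 - ε := by
    rw [hv, hk₀, hh₀]
    nlinarith
  have hexp₃ : -v + -b + (3 * c - 1 + (h₀ - b) + v + h₀) / 2 ≤ 1 - ε := by
    rw [hv, hb, hh₀]
    nlinarith
  intro x G ω φ T hx h hT hG Z M w hwZ hM
  rw [← hv] at hG
  have hx0 : 0 < x := by linarith
  have hadd : ∀ a b : ℝ, x ^ a * x ^ b = x ^ (a + b) := fun a b => (Real.rpow_add hx0 a b).symm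
  have hle : ∀ {a b : ℝ}, a ≤ b → x ^ a ≤ x ^ b := fun hab =>
    Real.rpow_le_rpow_of_exponent_le hx hab
  have h1le : ∀ {a : ℝ}, 0 ≤ a → 1 ≤ x ^ a := fun ha => Real.one_le_rpow hx ha
  have hmul : ∀ a b : ℝ, (x ^ a) ^ b = x ^ (a * b) := fun a b => (Real.rpow_mul hx0.le a b).symm
  have hinv : ∀ a : ℝ, (x ^ a)⁻¹ = x ^ (-a) := fun a => (Real.rpow_neg hx0.le a).symm
  have hpos : ∀ a : ℝ, 0 < x ^ a := fun a => Real.rpow_pos_of_pos hx0 a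
  obtain ⟨r, hr1, hrV, hVr⟩ := exists_fib_mem_Icc (h1le hv0)
  obtain ⟨s₁, hs₁⟩ : ∃ y : ℝ, y = x ^ (1 - ε) := ⟨_, rfl⟩
  have hs₁1 : 1 ≤ s₁ := hs₁ ▸ h1le (by linarith)
  have hs₁b : s₁ ^ (c - 1) = x ^ b := by rw [hs₁, hmul, hb]
  obtain ⟨K, hK⟩ : ∃ y : ℝ, y = x ^ v / (c * s₁ ^ (c - 1)) := ⟨_, rfl⟩
  have hKk : K ≤ x ^ k₀ := by
    rw [hK, hs₁b, div_le_iff₀ (by have := hpos b; positivity), mul_left_comm, hadd]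
    have : k₀ + b = v := by rw [hk₀, hb, hv]; ring
    rw [this]
    exact le_mul_of_one_le_left (hpos v).le hc.le
  have hK0 : 0 ≤ K := by
    have := hpos v
    have := hpos b
    rw [hK, hs₁b]
    positivity
  have hKs : K ≤ s₁ := hs₁ ▸ hKk.trans (hle hks)
  have hKV : K * (c * s₁ ^ (c - 1)) = x ^ v := by
    have := hpos b
    rw [hK, hs₁b]
    field_simp
  obtain ⟨H, hH⟩ : ∃ y : ℕ, y = ⌈x ^ h₀⌉₊ := ⟨_, rfl⟩
  have hHle : x ^ h₀ ≤ H := hH ▸ Nat.le_ceil _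
  have hHge : (H : ℝ) ≤ 2 * x ^ h₀ := by
    have := Nat.ceil_lt_add_one (hpos h₀).le
    rw [← hH] at this
    linarith [h1le hh₀0]
  have hHpos : (0 : ℝ) < H := (hpos h₀).trans_le hHle
  have hH0 : H ≠ 0 := by
    rintro h0
    rw [h0] at hHpos
    simp at hHpos
  obtain ⟨Y, hY⟩ : ∃ y : ℝ, y = 3 * x ^ c := ⟨_, rfl⟩
  rw [← hY] at hwZ
  have hYpos : 0 < Y := by
    have := hpos c
    rw [hY]
    positivity
  have hs₁c : s₁ ^ c = x ^ ((1 - ε) * c) := by rw [hs₁, hmul]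
  have hXY : s₁ ^ c ≤ Y := by
    rw [hs₁c, hY]
    have : x ^ ((1 - ε) * c) ≤ x ^ c := hle hcε
    linarith [hpos c]
  have hYpow : ∀ {a : ℝ}, 0 ≤ a → ∀ d : ℝ, a ≤ d → Y ^ a ≤ 3 ^ d * x ^ (c * a) := by
    intro a ha d had
    rw [hY, Real.mul_rpow (by norm_num) (hpos c).le, hmul]
    have : (3 : ℝ) ^ a ≤ 3 ^ d := Real.rpow_le_rpow_of_exponent_le (by norm_num) had
    have := hpos (c * a)
    gcongr
  have hMY : Y ^ (1 / c) + K + 1 ≤ M := by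
    have h1 := hYpow (by positivity : 0 ≤ 1 / c) 1 (by rw [div_le_one hc0]; exact hc.le)
    rw [mul_one_div_cancel hc0.ne', Real.rpow_one, Real.rpow_one] at h1
    have h2 : s₁ ≤ x := by
      calc s₁ ≤ x ^ (1 : ℝ) := hs₁ ▸ hle (by linarith)
        _ = x := Real.rpow_one x
    linarith
  have hlog0 : 0 ≤ Real.log (1 + (H : ℝ) ^ 2) := Real.log_nonneg (by nlinarith)
  have hlog : Real.log (1 + (H : ℝ) ^ 2) ≤ 40 / ε * x ^ (ε / 2) := by
    have h1 : 1 + (H : ℝ) ^ 2 ≤ 5 * x ^ (4 : ℝ) := by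
      have h2 : (H : ℝ) ^ 2 ≤ (2 * x ^ (2 : ℝ)) ^ 2 := by
        have : x ^ h₀ ≤ x ^ (2 : ℝ) := hle (by rw [hh₀]; linarith)
        gcongr
        linarith
      have h3 : (2 * x ^ (2 : ℝ)) ^ 2 = 4 * x ^ (4 : ℝ) := by
        rw [mul_pow, ← Real.rpow_natCast (x ^ (2 : ℝ)), hmul]
        norm_num
      rw [h3] at h2
      linarith [h1le (show (0 : ℝ) ≤ 4 by norm_num)]
    have h2 := hpos 4
    calc Real.log (1 + (H : ℝ) ^ 2) ≤ (1 + (H : ℝ) ^ 2) ^ (ε / 8) / (ε / 8) :=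
          Real.log_le_rpow_div (by positivity) (by positivity)
      _ ≤ (5 * x ^ (4 : ℝ)) ^ (ε / 8) / (ε / 8) := by gcongr
      _ = 5 ^ (ε / 8) * x ^ (ε / 2) / (ε / 8) := by
          rw [Real.mul_rpow (by norm_num) h2.le, hmul]
          congr 3
          ring
      _ ≤ 5 * x ^ (ε / 2) / (ε / 8) := by
          have : (5 : ℝ) ^ (ε / 8) ≤ 5 ^ (1 : ℝ) :=
            Real.rpow_le_rpow_of_exponent_le (by norm_num) (by linarith)
          rw [Real.rpow_one] at this
          have := hpos (ε / 2)
          gcongr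
      _ = 40 / ε * x ^ (ε / 2) := by ring
  have hαY : c * Y ^ (1 - 1 / c) ≤ 6 * x ^ (c - 1) := by
    have h1 := hYpow hγ.le 1 (by have : 0 < 1 / c := by positivity
                                 linarith)
    rw [Real.rpow_one, mul_sub, mul_one_div_cancel hc0.ne', mul_one] at h1
    calc c * Y ^ (1 - 1 / c) ≤ 2 * (3 * x ^ (c - 1)) := by gcongr; linarith
      _ = _ := by ring
  have hk1 : 1 ≤ x ^ k₀ := h1le hk₀0
  have hE1 : (2 * K + 1) * (2 * x ^ ε * ((c - 1) * K ^ 2 * s₁ ^ (c - 2))) ≤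
      6 * x ^ (3 * k₀ + ε + (1 - ε) * (c - 2)) := by
    have hs2 : s₁ ^ (c - 2) = x ^ ((1 - ε) * (c - 2)) := by rw [hs₁, hmul]
    have h0 := hpos ε
    have h0' := hpos ((1 - ε) * (c - 2))
    calc (2 * K + 1) * (2 * x ^ ε * ((c - 1) * K ^ 2 * s₁ ^ (c - 2)))
        ≤ (3 * x ^ k₀) * (2 * x ^ ε * (1 * (x ^ k₀) ^ 2 * x ^ ((1 - ε) * (c - 2)))) := by
          rw [hs2]
          have : 0 ≤ c - 1 := by linarith
          gcongr
          · linarith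
          · linarith
      _ = 6 * (x ^ k₀ * x ^ k₀ * x ^ k₀ * x ^ ε * x ^ ((1 - ε) * (c - 2))) := by ring
      _ = _ := by
          rw [hadd, hadd, hadd, hadd]
          congr 2
          ring
  have hE2 : (2 * K + 2) *
      (2 * x ^ ε * (c * Y ^ (1 - 1 / c)) * (Real.log (1 + H ^ 2) / (2 * H))) ≤
      24 * (40 / ε) * x ^ (k₀ + ε + (c - 1) + ε / 2 - h₀) := by
    have h0 := hpos ε
    have h0' := hpos (c - 1)
    have h0'' := hpos h₀
    have hYγ : 0 < Y ^ (1 - 1 / c) := by positivity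
    calc (2 * K + 2) * (2 * x ^ ε * (c * Y ^ (1 - 1 / c)) * (Real.log (1 + H ^ 2) / (2 * H)))
        ≤ (4 * x ^ k₀) * (2 * x ^ ε * (6 * x ^ (c - 1)) *
            (40 / ε * x ^ (ε / 2) / (2 * x ^ h₀))) := by
          gcongr
          linarith
      _ = 24 * (40 / ε) * (x ^ k₀ * x ^ ε * x ^ (c - 1) * x ^ (ε / 2) * (x ^ h₀)⁻¹) := by
          ring
      _ = _ := by rw [hinv, hadd, hadd, hadd, hadd, ← sub_eq_add_neg]
  obtain ⟨E, hE⟩ : ∃ y : ℝ, y = 6 * x ^ (3 * k₀ + ε + (1 - ε) * (c - 2)) +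
    24 * (40 / ε) * x ^ (k₀ + ε + (c - 1) + ε / 2 - h₀) := ⟨_, rfl⟩
  have hX0 : 0 < s₁ ^ c := by rw [hs₁c]; exact hpos _
  obtain ⟨Q, hQ⟩ : ∃ y : ℝ, y = q * x ^ (3 * c - 1 + (h₀ - b) + v + h₀) := ⟨_, rfl⟩
  obtain ⟨D₀, hD₀⟩ : ∃ y : ℝ, y = max ‖∑ v ∈ Finset.range (Nat.fib r), φ v‖
    ‖∑ v ∈ Finset.range (Nat.fib (r + 1)), φ v‖ := ⟨_, rfl⟩
  have hI : ∀ k, r ≤ k → k ≤ r + 1 →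
      ∫ t in (s₁ ^ c)..Y, fejerMean φ (Nat.fib k) H (c * t ^ (1 - 1 / c)) ≤
        Y * D₀ + 4 * √Q := by
    intro k hk1 hk2
    refine (integral_fejerMean_le h.norm_le hc hX0 hXY (Nat.fib k) hH0).trans ?_
    have hsum : ‖∑ v ∈ Finset.range (Nat.fib k), φ v‖ ≤ D₀ := by
      obtain rfl | rfl : k = r ∨ k = r + 1 := by omega
      · exact hD₀ ▸ le_max_left _ _
      · exact hD₀ ▸ le_max_right _ _
    have hQle : Y * (c * Y ^ (2 - 1 / c) / (1 - 1 / c) *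
        (H / (c * (s₁ ^ c) ^ (1 - 1 / c)) + 1) * Nat.fib k) * H ≤ Q := by
      have hfk : (Nat.fib k : ℝ) ≤ x ^ v :=
        le_trans (by exact_mod_cast Nat.fib_mono hk2) hrV
      have e1 : (s₁ ^ c) ^ (1 - 1 / c) = x ^ b := by
        rw [hs₁c, hmul, hb]
        congr 1
        field_simp
      have e2 : Y ^ (2 - 1 / c) ≤ 9 * x ^ (2 * c - 1) := by
        have h1 := hYpow (by linarith : 0 ≤ 2 - 1 / c) 2 (by have : 0 < 1 / c := by positivity
                                                             linarith)
        have h2 : c * (2 - 1 / c) = 2 * c - 1 := by field_simp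
        rw [h2] at h1
        norm_num at h1 ⊢
        exact h1
      have hxb := hpos b
      have e3 : (H : ℝ) / (c * x ^ b) + 1 ≤ 3 * x ^ (h₀ - b) := by
        have h1 : (H : ℝ) / (c * x ^ b) ≤ 2 * x ^ (h₀ - b) := by
          rw [div_le_iff₀ (by positivity)]
          calc (H : ℝ) ≤ 2 * x ^ h₀ := hHge
            _ = 2 * x ^ (h₀ - b) * (1 * x ^ b) := by
                rw [one_mul, mul_assoc, hadd, sub_add_cancel]
            _ ≤ 2 * x ^ (h₀ - b) * (c * x ^ b) := by
                have := hpos (h₀ - b)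
                gcongr
        have h2 : 1 ≤ x ^ (h₀ - b) := h1le hhb
        linarith
      have p1 := hpos (2 * c - 1)
      have p2 := hpos (h₀ - b)
      have p3 := hpos v
      have p4 := hpos h₀
      have p5 := hpos c
      have p6 : 0 < Y ^ (2 - 1 / c) := by positivity
      rw [e1]
      calc Y * (c * Y ^ (2 - 1 / c) / (1 - 1 / c) * (H / (c * x ^ b) + 1) * Nat.fib k) * H
          ≤ (3 * x ^ c) * (c * (9 * x ^ (2 * c - 1)) / (1 - 1 / c) * (3 * x ^ (h₀ - b)) * x ^ v) *
            (2 * x ^ h₀) := by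
            gcongr
            exact hY.le
        _ = q * (x ^ c * x ^ (2 * c - 1) * x ^ (h₀ - b) * x ^ v * x ^ h₀) := by
            rw [hq]
            ring
        _ = Q := by
            rw [hadd, hadd, hadd, hadd, hQ]
            congr 2
            ring
    have := Real.sqrt_le_sqrt hQle
    gcongr
  have hmain := norm_sum_blockFun_le_of_integral_le (K := K) (E := E) (H := H) (M := M) h hT hc
    (by linarith) hs₁1 hr1 hKs (hKV ▸ hrV) hXY hH0 hMY (hE ▸ add_le_add hE1 hE2) hI Z w hwZ
  refine hmain.trans ?_
  have hfr : (0 : ℝ) < Nat.fib r := by linarith [hpos v]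
  have hfr' : (Nat.fib r : ℝ)⁻¹ ≤ 4 * x ^ (-v) := by
    rw [← hinv, inv_le_iff_one_le_mul₀ hfr, mul_assoc, ← mul_comm (Nat.fib r : ℝ), ← mul_assoc,
      ← div_eq_mul_inv, one_le_div (hpos v)]
    exact hVr
  have hμ0 : 0 ≤ ∫ u, T u := MeasureTheory.integral_nonneg hT.nonneg
  have hμ1 := hT.integral_le_one
  have hG0 : 0 ≤ G := by
    refine nonneg_of_mul_nonneg_left (le_trans ?_ (hG r hVr)) hfr
    positivity
  have hdiag : (∫ u, T u) * D₀ ≤ 2 * G * Nat.fib r := by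
    have g1 := hG r hVr
    have g2 := hG (r + 1) (hVr.trans (by
      have : (Nat.fib r : ℝ) ≤ Nat.fib (r + 1) := by exact_mod_cast Nat.fib_le_fib_succ
      linarith))
    have g3 : (Nat.fib (r + 1) : ℝ) ≤ 2 * Nat.fib r := by
      obtain ⟨s, rfl⟩ : ∃ s, r = s + 1 := ⟨r - 1, by omega⟩
      have e2 : Nat.fib (s + 1 + 1) = Nat.fib s + Nat.fib (s + 1) := Nat.fib_add_two
      have e3 : Nat.fib s ≤ Nat.fib (s + 1) := Nat.fib_le_fib_succ
      exact_mod_cast (by omega : Nat.fib (s + 1 + 1) ≤ 2 * Nat.fib (s + 1))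
    rw [hD₀, mul_max_of_nonneg _ _ hμ0]
    refine max_le ?_ ?_
    · have := mul_nonneg hG0 hfr.le
      linarith only [g1, this]
    · have := mul_le_mul_of_nonneg_left g3 hG0
      linarith only [g2, this]
  have t1 : (Nat.fib r : ℝ)⁻¹ * (Y * E) ≤
      72 * x ^ (1 - ε) + 12 * (24 * (40 / ε)) * x ^ (1 - ε) := by
    have hE0 : 0 ≤ E := by
      have := hpos (3 * k₀ + ε + (1 - ε) * (c - 2))
      have := hpos (k₀ + ε + (c - 1) + ε / 2 - h₀)
      rw [hE]
      positivity
    calc (Nat.fib r : ℝ)⁻¹ * (Y * E) ≤ 4 * x ^ (-v) * (Y * E) := by gcongr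
      _ = 72 * (x ^ (-v) * x ^ c * x ^ (3 * k₀ + ε + (1 - ε) * (c - 2))) +
          12 * (24 * (40 / ε)) *
            (x ^ (-v) * x ^ c * x ^ (k₀ + ε + (c - 1) + ε / 2 - h₀)) := by
          rw [hY, hE]
          ring
      _ ≤ _ := by
          rw [hadd, hadd, hadd]
          refine add_le_add (mul_le_mul_of_nonneg_left (hle ?_) (by norm_num))
            (mul_le_mul_of_nonneg_left (hle ?_) (by positivity))
          · exact hexp₁
          · exact hexp₂
  have hxb := hpos b
  have t2 : (Nat.fib r : ℝ)⁻¹ * ((∫ u, T u) / (c * s₁ ^ (c - 1)) * (2 * (4 * √Q))) ≤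
      32 * √q * x ^ (1 - ε) := by
    have hsq : √Q = √q * x ^ ((3 * c - 1 + (h₀ - b) + v + h₀) / 2) := by
      rw [hQ, Real.sqrt_mul hq0, Real.sqrt_eq_rpow (x ^ _), hmul]
      congr 2
      ring
    have h1 : (∫ u, T u) / (c * s₁ ^ (c - 1)) ≤ x ^ (-b) := by
      rw [hs₁b, div_le_iff₀ (by positivity), mul_left_comm, hadd, neg_add_cancel, Real.rpow_zero]
      linarith
    have p1 := hpos (-v)
    have p2 := hpos (-b)
    calc (Nat.fib r : ℝ)⁻¹ * ((∫ u, T u) / (c * s₁ ^ (c - 1)) * (2 * (4 * √Q)))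
        ≤ (4 * x ^ (-v)) * (x ^ (-b) * (2 * (4 * √Q))) := by gcongr
      _ = 32 * √q * (x ^ (-v) * x ^ (-b) * x ^ ((3 * c - 1 + (h₀ - b) + v + h₀) / 2)) := by
          rw [hsq]
          ring
      _ ≤ _ := by
          rw [hadd, hadd]
          refine mul_le_mul_of_nonneg_left (hle hexp₃) (by positivity)
  have t3 : (Nat.fib r : ℝ)⁻¹ * ((∫ u, T u) / (c * s₁ ^ (c - 1)) * (2 * (Y * D₀))) ≤
      48 * (x ^ (1 + (c - 1) * ε) * G) := by
    have h1 : (Nat.fib r : ℝ)⁻¹ * ((∫ u, T u) * D₀) ≤ 2 * G := by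
      rw [inv_mul_le_iff₀ hfr]
      linarith
    have h2 : (c * s₁ ^ (c - 1))⁻¹ ≤ x ^ (-b) := by
      rw [hs₁b, ← hinv]
      gcongr
      exact le_mul_of_one_le_left hxb.le hc.le
    calc (Nat.fib r : ℝ)⁻¹ * ((∫ u, T u) / (c * s₁ ^ (c - 1)) * (2 * (Y * D₀)))
        = 2 * Y * (c * s₁ ^ (c - 1))⁻¹ * ((Nat.fib r : ℝ)⁻¹ * ((∫ u, T u) * D₀)) := by
          rw [div_eq_mul_inv]
          ring
      _ ≤ 2 * Y * x ^ (-b) * (2 * G) := by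
          have := hpos (-b)
          have : 0 ≤ (∫ u, T u) * D₀ := mul_nonneg hμ0 (by rw [hD₀]; positivity)
          gcongr
      _ = 12 * (x ^ c * x ^ (-b) * G) := by
          rw [hY]
          ring
      _ = 12 * (x ^ (1 + (c - 1) * ε) * G) := by
          rw [hadd]
          congr 3
          rw [hb]
          ring
      _ ≤ _ := by
          have := hpos (1 + (c - 1) * ε)
          have : 0 ≤ x ^ (1 + (c - 1) * ε) * G := by positivity
          linarith
  have hs2 : 5 * s₁ + 2 ≤ 7 * x ^ (1 - ε) := by rw [← hs₁]; linarith
  have p1 := hpos (1 - ε)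
  have p2 : 0 ≤ x ^ (1 + (c - 1) * ε) * G := by
    have := hpos (1 + (c - 1) * ε)
    positivity
  have hsplit : (Nat.fib r : ℝ)⁻¹ *
      (Y * E + (∫ u, T u) / (c * s₁ ^ (c - 1)) * (2 * (Y * D₀ + 4 * √Q))) =
      (Nat.fib r : ℝ)⁻¹ * (Y * E) +
      (Nat.fib r : ℝ)⁻¹ * ((∫ u, T u) / (c * s₁ ^ (c - 1)) * (2 * (4 * √Q))) +
      (Nat.fib r : ℝ)⁻¹ * ((∫ u, T u) / (c * s₁ ^ (c - 1)) * (2 * (Y * D₀))) := by ring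
  rw [hsplit]
  have hCexp : C * (x ^ (1 - ε) + x ^ (1 + (c - 1) * ε) * G) =
      7 * x ^ (1 - ε) + (72 * x ^ (1 - ε) + 12 * (24 * (40 / ε)) * x ^ (1 - ε)) +
      32 * √q * x ^ (1 - ε) + 48 * (x ^ (1 + (c - 1) * ε) * G) + 48 * x ^ (1 - ε) +
      (7 + 72 + 12 * (24 * (40 / ε)) + 32 * √q) * (x ^ (1 + (c - 1) * ε) * G) := by
    rw [hC]
    ring
  have p3 : 0 ≤ (7 + 72 + 12 * (24 * (40 / ε)) + 32 * √q) * (x ^ (1 + (c - 1) * ε) * G) := by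
    positivity
  rw [hCexp]
  linarith

end Parameters

section Conclusion

/-- The trapezoid of slope `L` on `[0, 1]`. -/
noncomputable def trapezoid (L u : ℝ) : ℝ := max 0 (min 1 (min (L * u) (L * (1 - u))))

/-- The tent of slope `L` centred at `1 / 2`. -/
noncomputable def tent (L u : ℝ) : ℝ := max 0 (1 - L * |u - 1 / 2|)

theorem isBump_trapezoid {L : ℝ} (hL : 0 ≤ L) : IsBump L (trapezoid L) where
  nonneg _ := le_max_left _ _
  le_one _ := max_le zero_le_one (min_le_left _ _)
  abs_sub_le x y := by
    have h1 : |L * x - L * y| = L * |x - y| := by rw [← mul_sub, abs_mul, abs_of_nonneg hL]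
    have h2 : |L * (1 - x) - L * (1 - y)| = L * |x - y| := by
      rw [← mul_sub, abs_mul, abs_of_nonneg hL, sub_sub_sub_cancel_left, abs_sub_comm]
    have h3 : 0 ≤ L * |x - y| := by positivity
    refine (abs_max_sub_max_le_max _ _ _ _).trans (max_le (by simpa using h3) ?_)
    refine (abs_min_sub_min_le_max _ _ _ _).trans (max_le (by simpa using h3) ?_)
    exact (abs_min_sub_min_le_max _ _ _ _).trans (max_le h1.le h2.le)
  eq_zero_of_nonpos x hx := max_eq_left <| (min_le_right _ _).trans <|
    (min_le_left _ _).trans (mul_nonpos_of_nonneg_of_nonpos hL hx)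
  eq_zero_of_one_le x hx := max_eq_left <| (min_le_right _ _).trans <|
    (min_le_right _ _).trans (mul_nonpos_of_nonneg_of_nonpos hL (by linarith))

theorem tent_eq_zero {L u : ℝ} (h : 1 ≤ L * |u - 1 / 2|) : tent L u = 0 :=
  max_eq_left (by linarith)

theorem isBump_tent {L : ℝ} (hL : 2 ≤ L) : IsBump L (tent L) where
  nonneg _ := le_max_left _ _
  le_one x := max_le zero_le_one (by have : 0 ≤ L * |x - 1 / 2| := by positivity
                                     linarith)
  abs_sub_le x y := by
    have h3 : 0 ≤ L * |x - y| := by positivity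
    refine (abs_max_sub_max_le_max _ _ _ _).trans (max_le (by simpa using h3) ?_)
    rw [sub_sub_sub_cancel_left, ← mul_sub, abs_mul, abs_of_nonneg (by linarith)]
    refine mul_le_mul_of_nonneg_left ?_ (by linarith)
    refine (abs_abs_sub_abs_le_abs_sub _ _).trans ?_
    rw [sub_sub_sub_cancel_right, abs_sub_comm]
  eq_zero_of_nonpos x hx := tent_eq_zero (by
    have := neg_le_abs (x - 1 / 2)
    nlinarith)
  eq_zero_of_one_le x hx := tent_eq_zero (by
    have := le_abs_self (x - 1 / 2)
    nlinarith)

theorem integral_tent_le {L : ℝ} (hL : 2 ≤ L) : ∫ u, tent L u ≤ 2 * L⁻¹ := by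
  have h0 : 0 < L⁻¹ := by positivity
  have h1 : L * L⁻¹ = 1 := mul_inv_cancel₀ (by linarith)
  refine ((isBump_tent hL).integral_le (a := 1 / 2 - L⁻¹) (b := 1 / 2 + L⁻¹) (by linarith)
    fun u hu => tent_eq_zero ?_).trans (by linarith)
  refine h1.symm.le.trans (mul_le_mul_of_nonneg_left ?_ (by linarith))
  rcases hu with hu | hu
  · linarith [neg_le_abs (u - 1 / 2)]
  · linarith [le_abs_self (u - 1 / 2)]

theorem one_sub_trapezoid_le_tent {L y : ℝ} (hL : 2 ≤ L) (hy : 0 ≤ y) :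
    1 - trapezoid L (y - ⌊y⌋₊) ≤ tent L (y + 1 / 2 - ⌊y + 1 / 2⌋₊) := by
  have a1 := Nat.floor_le hy
  have a2 := Nat.lt_floor_add_one y
  have b1 := Nat.floor_le (by linarith : 0 ≤ y + 1 / 2)
  have b2 := Nat.lt_floor_add_one (y + 1 / 2)
  have hk : ⌊y + 1 / 2⌋₊ = ⌊y⌋₊ ∨ ⌊y + 1 / 2⌋₊ = ⌊y⌋₊ + 1 := by
    have c1 : ⌊y⌋₊ < ⌊y + 1 / 2⌋₊ + 1 := by
      have : (⌊y⌋₊ : ℝ) < ⌊y + 1 / 2⌋₊ + 1 := by linarith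
      exact_mod_cast this
    have c2 : ⌊y + 1 / 2⌋₊ < ⌊y⌋₊ + 2 := by
      have : (⌊y + 1 / 2⌋₊ : ℝ) < ⌊y⌋₊ + 2 := by linarith
      exact_mod_cast this
    omega
  have hu1 : 0 ≤ y - ⌊y⌋₊ := by linarith
  have hu2 : 0 ≤ 1 - (y - ⌊y⌋₊) := by linarith
  suffices h : 1 - tent L (y + 1 / 2 - ⌊y + 1 / 2⌋₊) ≤ trapezoid L (y - ⌊y⌋₊) by linarith
  refine le_max_of_le_right (le_min ?_ (le_min ?_ ?_))
  · linarith [(isBump_tent hL).nonneg (y + 1 / 2 - ⌊y + 1 / 2⌋₊)]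
  all_goals
    have h1 := le_max_right 0 (1 - L * |y + 1 / 2 - ⌊y + 1 / 2⌋₊ - 1 / 2|)
    have h2 : |y + 1 / 2 - ⌊y + 1 / 2⌋₊ - 1 / 2| ≤ y - ⌊y⌋₊ ∧
        |y + 1 / 2 - ⌊y + 1 / 2⌋₊ - 1 / 2| ≤ 1 - (y - ⌊y⌋₊) := by
      rcases hk with hk | hk <;> rw [hk] at b1 b2 ⊢ <;> push_cast at b1 b2 ⊢
      · rw [abs_of_nonneg (by linarith)]
        constructor <;> linarith
      · rw [abs_of_nonpos (by linarith)]
        constructor <;> linarith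
    change 1 - max 0 (1 - L * |y + 1 / 2 - ⌊y + 1 / 2⌋₊ - 1 / 2|) ≤ _
  · have := mul_le_mul_of_nonneg_left h2.1 (by linarith : 0 ≤ L)
    linarith
  · have := mul_le_mul_of_nonneg_left h2.2 (by linarith : 0 ≤ L)
    linarith

theorem exists_norm_sum_pow_sZ_le {c : ℝ} (hc : 1 < c) (hc' : c < 4 / 3) {ω : ℂ} (hω : ‖ω‖ = 1)
    (h1 : ω ≠ 1) : ∃ δ C : ℝ, 0 < δ ∧ δ ≤ 1 ∧ 0 ≤ C ∧ ∀ N : ℕ, 1 ≤ N →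
      ‖∑ n ∈ Finset.Icc 1 N, ω ^ sZ ⌊(n : ℝ) ^ c⌋₊‖ ≤ C * (N : ℝ) ^ (1 - δ) := by
  have hφ := fibMultiplicative_pow_sZ hω
  have hφ₁ := fibMultiplicative_pow_sZ (ω := 1) (by simp)
  simp only [one_pow] at hφ₁
  obtain ⟨η, C₀, hη0, hη1, hC₀, hdig⟩ := hφ.exists_norm_sum_le h1
  obtain ⟨ε, hε⟩ : ∃ y, y = min ((1 - 3 / 4 * c) / 6) (η / 8) := ⟨_, rfl⟩
  have hε0 : 0 < ε := by rw [hε]; exact lt_min (by linarith) (by linarith)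
  have hε1 : ε ≤ (1 - 3 / 4 * c) / 6 := hε ▸ min_le_left _ _
  have hε2 : ε ≤ η / 8 := hε ▸ min_le_right _ _
  obtain ⟨C, hC0, hC⟩ := exists_norm_sum_blockFun_le hc hc' hε0 hε1
  refine ⟨ε / 2, C * (1 + 4 * C₀) + C * 3 + 2, by positivity, by linarith, by positivity,
    fun N hN => ?_⟩
  obtain ⟨x, hx⟩ : ∃ x : ℝ, x = N := ⟨_, rfl⟩
  have hx1 : 1 ≤ x := by rw [hx]; exact_mod_cast hN
  have hx0 : 0 < x := by linarith
  have hle : ∀ {a b : ℝ}, a ≤ b → x ^ a ≤ x ^ b := fun hab =>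
    Real.rpow_le_rpow_of_exponent_le hx1 hab
  have hpos : ∀ a : ℝ, 0 < x ^ a := fun a => Real.rpow_pos_of_pos hx0 a
  have hadd : ∀ a b : ℝ, x ^ a * x ^ b = x ^ (a + b) := fun a b => (Real.rpow_add hx0 a b).symm
  have hxc : 1 ≤ x ^ c := Real.one_le_rpow hx1 (by linarith)
  have htriv : ‖∑ n ∈ Finset.Icc 1 N, ω ^ sZ ⌊(n : ℝ) ^ c⌋₊‖ ≤ x := by
    refine (norm_sum_le _ _).trans ?_
    simp [hω, hx]
  rw [← hx]
  have hfin : 0 ≤ x ^ (1 - ε / 2) := (hpos _).le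
  by_cases hL : x ^ ε < 2
  · have e1 : x = x ^ ε * x ^ (1 - ε) := by
      rw [hadd, add_sub_cancel, Real.rpow_one]
    have e2 : x ^ ε * x ^ (1 - ε) ≤ 2 * x ^ (1 - ε / 2) := by
      have := hle (show 1 - ε ≤ 1 - ε / 2 by linarith)
      have := hpos (1 - ε)
      gcongr
    have e3 : 0 ≤ (C * (1 + 4 * C₀) + C * 3) * x ^ (1 - ε / 2) := by positivity
    linarith
  rw [not_lt] at hL
  have hL0 : 0 ≤ x ^ ε := by linarith
  have hT := isBump_trapezoid hL0
  have hS := isBump_tent hL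
  obtain ⟨M, hM⟩ : ∃ M : ℕ, M = 4 * N + 1 := ⟨_, rfl⟩
  have hMx : 4 * x + 1 ≤ M := by rw [hM, hx]; push_cast; rfl
  have hsub : Finset.Icc 1 N ⊆ Finset.range M := fun n hn => by
    rw [Finset.mem_Icc] at hn
    rw [Finset.mem_range]
    omega
  have hmono : ∀ n ∈ Finset.Icc 1 N, (n : ℝ) ^ c ≤ x ^ c := fun n hn => by
    rw [hx]
    have : n ≤ N := (Finset.mem_Icc.1 hn).2
    gcongr
  have hv : 1 / 4 ≤ c / 2 - 2 * ε := by linarith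
  have hG₁ : ∀ k, x ^ (c / 2 - 2 * ε) ≤ 4 * Nat.fib k → (∫ u, trapezoid (x ^ ε) u) *
      ‖∑ v ∈ Finset.range (Nat.fib k), ω ^ sZ v‖ ≤ 4 * C₀ * x ^ (-(η / 4)) * Nat.fib k := by
    intro k hk
    have hxk : x ^ (1 / 4 : ℝ) ≤ 4 * Nat.fib k := (hle hv).trans hk
    have hk0 : (0 : ℝ) < Nat.fib k := by linarith [hpos (1 / 4)]
    have hsum : ‖∑ v ∈ Finset.range (Nat.fib k), ω ^ sZ v‖ ≤
        C₀ * (Nat.fib k : ℝ) ^ (1 - η) := by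
      match k, hk0 with
      | 0, hk0 => simp at hk0
      | 1, _ => exact hdig 0
      | k + 2, _ => exact hdig k
    have hpow : x ^ (η / 4) ≤ 4 * (Nat.fib k : ℝ) ^ η := by
      calc x ^ (η / 4) = (x ^ (1 / 4 : ℝ)) ^ η := by
            rw [← Real.rpow_mul hx0.le]
            congr 1
            ring
        _ ≤ (4 * Nat.fib k) ^ η := by
            have := hpos (1 / 4)
            gcongr
        _ = 4 ^ η * (Nat.fib k : ℝ) ^ η := Real.mul_rpow (by norm_num) hk0.le
        _ ≤ 4 * (Nat.fib k : ℝ) ^ η := by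
            have : (4 : ℝ) ^ η ≤ 4 ^ (1 : ℝ) :=
              Real.rpow_le_rpow_of_exponent_le (by norm_num) hη1.le
            rw [Real.rpow_one] at this
            gcongr
    have hfib : (Nat.fib k : ℝ) ^ (1 - η) ≤ 4 * x ^ (-(η / 4)) * Nat.fib k := by
      have h2 : (Nat.fib k : ℝ) ^ (1 - η) * (Nat.fib k : ℝ) ^ η = Nat.fib k := by
        rw [← Real.rpow_add hk0, sub_add_cancel, Real.rpow_one]
      have h3 : x ^ (-(η / 4)) * x ^ (η / 4) = 1 := by
        rw [hadd, neg_add_cancel, Real.rpow_zero]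
      have h4 : 0 < (Nat.fib k : ℝ) ^ (1 - η) := by positivity
      have h5 := hpos (-(η / 4))
      calc (Nat.fib k : ℝ) ^ (1 - η)
          = (Nat.fib k : ℝ) ^ (1 - η) * (x ^ (-(η / 4)) * x ^ (η / 4)) := by rw [h3, mul_one]
        _ ≤ (Nat.fib k : ℝ) ^ (1 - η) * (x ^ (-(η / 4)) * (4 * (Nat.fib k : ℝ) ^ η)) := by
            gcongr
        _ = 4 * x ^ (-(η / 4)) * ((Nat.fib k : ℝ) ^ (1 - η) * (Nat.fib k : ℝ) ^ η) := by ring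
        _ = _ := by rw [h2]
    calc (∫ u, trapezoid (x ^ ε) u) * ‖∑ v ∈ Finset.range (Nat.fib k), ω ^ sZ v‖
        ≤ 1 * (C₀ * (4 * x ^ (-(η / 4)) * Nat.fib k)) := by
          have := hT.integral_le_one
          gcongr
          exact hsum.trans (by gcongr)
      _ = _ := by ring
  have hG₂ : ∀ k, x ^ (c / 2 - 2 * ε) ≤ 4 * Nat.fib k → (∫ u, tent (x ^ ε) u) *
      ‖∑ v ∈ Finset.range (Nat.fib k), (1 : ℂ)‖ ≤ 2 * x ^ (-ε) * Nat.fib k := by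
    intro k _
    have := integral_tent_le hL
    rw [Real.rpow_neg hx0.le]
    simp only [Finset.sum_const, Finset.card_range, nsmul_eq_mul, mul_one, Complex.norm_natCast]
    gcongr
  obtain ⟨Z₁, hZ₁⟩ : ∃ Z, Z = ⌊x ^ c⌋₊ + 1 := ⟨_, rfl⟩
  obtain ⟨Z₂, hZ₂⟩ : ∃ Z, Z = ⌊x ^ c + 1 / 2⌋₊ + 1 := ⟨_, rfl⟩
  have hZ₁' : (Z₁ : ℝ) ≤ x ^ c + 1 := by
    rw [hZ₁]
    push_cast
    linarith [Nat.floor_le (hpos c).le]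
  have hZ₂' : (Z₂ : ℝ) ≤ x ^ c + 3 / 2 := by
    rw [hZ₂]
    push_cast
    linarith [Nat.floor_le (by linarith : 0 ≤ x ^ c + 1 / 2)]
  have hbd₁ := hC x _ ω _ _ hx1 hφ hT hG₁ Z₁ M 0 (by linarith) hMx
  have hbd₂ := hC x _ 1 _ _ hx1 hφ₁ hS hG₂ Z₂ M (-(1 / 2)) (by linarith) hMx
  have hsum₁ : ∑ n ∈ Finset.range M, blockFun (fun n => ω ^ sZ n) (trapezoid (x ^ ε)) Z₁
      ((n : ℝ) ^ c - 0) = ∑ n ∈ Finset.Icc 1 N, ω ^ sZ ⌊(n : ℝ) ^ c⌋₊ *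
        (trapezoid (x ^ ε) ((n : ℝ) ^ c - ⌊(n : ℝ) ^ c⌋₊) : ℂ) := by
    refine (Finset.sum_subset hsub fun n _ hn => ?_).symm.trans (Finset.sum_congr rfl fun n hn => ?_)
    · rw [Finset.mem_Icc, not_and_or, not_le, not_le] at hn
      rcases hn with hn | hn
      · obtain rfl : n = 0 := by omega
        refine blockFun_eq_zero_of_nonpos hT _ ?_
        rw [Nat.cast_zero, Real.zero_rpow (by linarith), sub_zero]
      · refine blockFun_eq_zero_of_le hT ?_
        have h2 : x + 1 ≤ n := by rw [hx]; exact_mod_cast hn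
        have h3 : x ^ c + 1 ^ c ≤ (x + 1) ^ c := Real.add_rpow_le_rpow_add hx0.le zero_le_one hc.le
        have h4 : (x + 1) ^ c ≤ (n : ℝ) ^ c := by gcongr
        rw [Real.one_rpow] at h3
        linarith
    · rw [blockFun_eq hT, sub_zero, if_pos]
      rw [hZ₁, Nat.lt_succ_iff]
      exact Nat.floor_mono (hmono n hn)
  have hsum₂ : ∑ n ∈ Finset.Icc 1 N,
      (1 - trapezoid (x ^ ε) ((n : ℝ) ^ c - ⌊(n : ℝ) ^ c⌋₊)) ≤
      ‖∑ n ∈ Finset.range M, blockFun (fun _ => 1) (tent (x ^ ε)) Z₂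
        ((n : ℝ) ^ c - -(1 / 2))‖ := by
    have key : ∀ y, blockFun (fun _ => 1) (tent (x ^ ε)) Z₂ y =
        ((if ⌊y⌋₊ < Z₂ then tent (x ^ ε) (y - ⌊y⌋₊) else 0 : ℝ) : ℂ) := fun y => by
      rw [blockFun_eq hS]
      split_ifs <;> simp
    simp only [key]
    rw [← Complex.ofReal_sum, Complex.norm_real, Real.norm_eq_abs]
    refine le_trans ?_ (le_abs_self _)
    refine le_trans ?_ (Finset.sum_le_sum_of_subset_of_nonneg hsub fun n _ _ => ?_)
    · refine Finset.sum_le_sum fun n hn => ?_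
      rw [sub_neg_eq_add, if_pos]
      · exact one_sub_trapezoid_le_tent hL (by positivity)
      · rw [hZ₂, Nat.lt_succ_iff]
        exact Nat.floor_mono (by linarith [hmono n hn])
    · split_ifs
      · exact hS.nonneg _
      · exact le_rfl
  have hsplit : ‖∑ n ∈ Finset.Icc 1 N, ω ^ sZ ⌊(n : ℝ) ^ c⌋₊‖ ≤
      ‖∑ n ∈ Finset.Icc 1 N, ω ^ sZ ⌊(n : ℝ) ^ c⌋₊ *
        (trapezoid (x ^ ε) ((n : ℝ) ^ c - ⌊(n : ℝ) ^ c⌋₊) : ℂ)‖ +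
      ∑ n ∈ Finset.Icc 1 N, (1 - trapezoid (x ^ ε) ((n : ℝ) ^ c - ⌊(n : ℝ) ^ c⌋₊)) := by
    rw [← sub_le_iff_le_add']
    refine (norm_sub_norm_le _ _).trans ?_
    rw [← Finset.sum_sub_distrib]
    refine (norm_sum_le _ _).trans (Finset.sum_le_sum fun n _ => ?_)
    rw [← mul_one_sub, ← Complex.ofReal_one, ← Complex.ofReal_sub, norm_mul, norm_pow, hω, one_pow,
      one_mul, Complex.norm_real, Real.norm_of_nonneg (sub_nonneg.2 (hT.le_one _))]
  rw [hsum₁] at hbd₁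
  have f1 : x ^ (1 - ε) ≤ x ^ (1 - ε / 2) := hle (by linarith)
  have f2 : x ^ (1 + (c - 1) * ε) * (4 * C₀ * x ^ (-(η / 4))) ≤ 4 * C₀ * x ^ (1 - ε / 2) := by
    rw [mul_left_comm, hadd]
    exact mul_le_mul_of_nonneg_left (hle (by nlinarith)) (by positivity)
  have f3 : x ^ (1 + (c - 1) * ε) * (2 * x ^ (-ε)) ≤ 2 * x ^ (1 - ε / 2) := by
    rw [mul_left_comm, hadd]
    exact mul_le_mul_of_nonneg_left (hle (by nlinarith)) (by positivity)
  have g1 := hbd₁.trans (mul_le_mul_of_nonneg_left (add_le_add f1 f2) hC0)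
  have g2 := hsum₂.trans (hbd₂.trans (mul_le_mul_of_nonneg_left (add_le_add f1 f3) hC0))
  linarith

theorem sum_range_primitiveRoot_zpow {m : ℕ} {ζ : ℂ} (hζ : IsPrimitiveRoot ζ m) (k : ℤ) :
    ∑ j ∈ Finset.range m, (ζ ^ k) ^ j = if (m : ℤ) ∣ k then (m : ℂ) else 0 := by
  split_ifs with h
  · rw [(hζ.zpow_eq_one_iff_dvd k).2 h]
    simp
  · have h1 : ζ ^ k ≠ 1 := fun h' => h ((hζ.zpow_eq_one_iff_dvd k).1 h')
    rw [geom_sum_eq h1, ← zpow_natCast, ← zpow_mul, mul_comm, zpow_mul, zpow_natCast, hζ.pow_eq_one,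
      one_zpow, sub_self, zero_div]

theorem exists_sum_norm_sum_pow_sZ_le {c : ℝ} (hc : 1 < c) (hc' : c < 4 / 3) {m : ℕ}
    {ζ : ℂ} (hζ : IsPrimitiveRoot ζ m) {J : ℕ} (hJ : J < m) :
    ∃ δ C : ℝ, 0 < δ ∧ δ ≤ 1 ∧ 0 ≤ C ∧ ∀ N : ℕ, 1 ≤ N →
      ∑ j ∈ Finset.range J, ‖∑ n ∈ Finset.Icc 1 N, (ζ ^ (j + 1)) ^ sZ ⌊(n : ℝ) ^ c⌋₊‖ ≤
        C * (N : ℝ) ^ (1 - δ) := by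
  induction J with
  | zero => exact ⟨1, 0, one_pos, le_rfl, le_rfl, by simp⟩
  | succ J ih =>
    obtain ⟨δ₁, C₁, h1, h1', hC₁, hN₁⟩ := ih (by omega)
    have hω : ‖ζ ^ (J + 1)‖ = 1 := by rw [norm_pow, hζ.norm'_eq_one (by omega), one_pow]
    obtain ⟨δ₂, C₂, h2, h2', hC₂, hN₂⟩ := exists_norm_sum_pow_sZ_le hc hc' hω
      (hζ.pow_ne_one_of_pos_of_lt (by omega) hJ)
    refine ⟨min δ₁ δ₂, C₁ + C₂, lt_min h1 h2, (min_le_left _ _).trans h1', by positivity,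
      fun N hN => ?_⟩
    have hx1 : (1 : ℝ) ≤ N := by exact_mod_cast hN
    rw [Finset.sum_range_succ, add_mul]
    have e1 := min_le_left δ₁ δ₂
    have e2 := min_le_right δ₁ δ₂
    refine add_le_add ((hN₁ N hN).trans ?_) ((hN₂ N hN).trans ?_) <;> gcongr

end Conclusion

open Classical in
theorem stmt_10 (m : ℕ) (hm : 1 ≤ m) (a : ℤ) (c : ℝ) (hc : 1 < c) (hc' : c < 4 / 3) :
    ∃ ε : ℝ, 0 < ε ∧ ∃ C : ℝ, ∀ x : ℝ, 1 ≤ x →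
      |(((Finset.Icc 1 ⌊x⌋₊).filter (fun n =>
            (sZ ⌊(n : ℝ) ^ c⌋₊ : ℤ) ≡ a [ZMOD m])).card : ℝ) - x / m|
      ≤ C * x ^ (1 - ε) := by
  obtain ⟨ζ, hζ⟩ : ∃ ζ : ℂ, IsPrimitiveRoot ζ m := ⟨_, Complex.isPrimitiveRoot_exp m (by omega)⟩
  have hζ1 : ‖ζ‖ = 1 := hζ.norm'_eq_one (by omega)
  have hζ0 : ζ ≠ 0 := fun h => by simp [h] at hζ1
  obtain ⟨δ, C, hδ, hδ1, hC, hbound⟩ := exists_sum_norm_sum_pow_sZ_le hc hc' hζ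
    (J := m - 1) (by omega)
  refine ⟨δ, hδ, C + 1, fun x hx => ?_⟩
  have hm0 : (1 : ℝ) ≤ m := by exact_mod_cast hm
  obtain ⟨N, hN⟩ : ∃ N, N = ⌊x⌋₊ := ⟨_, rfl⟩
  have hN1 : 1 ≤ N := hN ▸ Nat.le_floor (by simpa using hx)
  have hNx : (N : ℝ) ≤ x := hN ▸ Nat.floor_le (by linarith)
  have hxN : x < N + 1 := hN ▸ Nat.lt_floor_add_one x
  rw [← hN]
  obtain ⟨A, hA⟩ : ∃ A : ℕ, A = ((Finset.Icc 1 N).filter (fun n : ℕ =>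
    (sZ ⌊(n : ℝ) ^ c⌋₊ : ℤ) ≡ a [ZMOD m])).card := ⟨_, rfl⟩
  have hcast : (do let n ← Finset.Icc 1 N; pure (n : ℝ)) =
      (Finset.Icc 1 N).image (fun n : ℕ => (n : ℝ)) := by
    ext y
    simp [Finset.bind_def, eq_comm]
  rw [hcast, Finset.filter_image, Finset.card_image_of_injective _ Nat.cast_injective, ← hA]
  have hcount : (m : ℂ) * A = N + ∑ j ∈ Finset.range (m - 1), (ζ ^ (j + 1)) ^ (-a) *
      ∑ n ∈ Finset.Icc 1 N, (ζ ^ (j + 1)) ^ sZ ⌊(n : ℝ) ^ c⌋₊ := by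
    have h1 : (m : ℂ) * A = ∑ n ∈ Finset.Icc 1 N, ∑ j ∈ Finset.range m,
        (ζ ^ ((sZ ⌊(n : ℝ) ^ c⌋₊ : ℤ) - a)) ^ j := by
      simp only [sum_range_primitiveRoot_zpow hζ]
      rw [hA, Finset.card_filter, Nat.cast_sum, Finset.mul_sum]
      refine Finset.sum_congr rfl fun n _ => ?_
      have : (sZ ⌊(n : ℝ) ^ c⌋₊ : ℤ) ≡ a [ZMOD m] ↔ (m : ℤ) ∣ (sZ ⌊(n : ℝ) ^ c⌋₊ : ℤ) - a :=
        ⟨fun h => Int.modEq_iff_dvd.1 h.symm, fun h => (Int.modEq_iff_dvd.2 h).symm⟩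
      by_cases h : (m : ℤ) ∣ (sZ ⌊(n : ℝ) ^ c⌋₊ : ℤ) - a
      · rw [if_pos h, if_pos (this.2 h)]
        simp
      · rw [if_neg h, if_neg fun h' => h (this.1 h')]
        simp
    rw [h1, Finset.sum_comm, ← Nat.sub_add_cancel hm, Finset.sum_range_succ', add_comm,
      Nat.add_sub_cancel]
    congr 1
    · simp
    · refine Finset.sum_congr rfl fun j _ => ?_
      rw [Finset.mul_sum]
      refine Finset.sum_congr rfl fun n _ => ?_
      rw [← zpow_natCast, ← zpow_mul, mul_comm, zpow_mul, zpow_natCast,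
        zpow_sub₀ (pow_ne_zero _ hζ0), zpow_natCast, zpow_neg, div_eq_mul_inv, mul_comm]
  have hdiff : |(m : ℝ) * A - N| ≤ C * (N : ℝ) ^ (1 - δ) := by
    rw [← Real.norm_eq_abs, ← Complex.norm_real]
    push_cast
    rw [hcount, add_sub_cancel_left]
    refine (norm_sum_le _ _).trans (le_trans (le_of_eq ?_) (hbound N hN1))
    refine Finset.sum_congr rfl fun j _ => ?_
    rw [norm_mul, norm_zpow, norm_pow, hζ1, one_pow, one_zpow, one_mul]
  have hNδ : (N : ℝ) ^ (1 - δ) ≤ x ^ (1 - δ) :=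
    Real.rpow_le_rpow (by positivity) hNx (by linarith)
  have hxδ : 1 ≤ x ^ (1 - δ) := Real.one_le_rpow hx (by linarith)
  have hCx := mul_le_mul_of_nonneg_left hNδ hC
  have hmx : |(m : ℝ) * A - x| ≤ (C + 1) * x ^ (1 - δ) := by
    rw [abs_le] at hdiff ⊢
    constructor <;> linarith
  have hdiv : (A : ℝ) - x / m = ((m : ℝ) * A - x) / m := by field_simp
  rw [hdiv, abs_div, abs_of_pos (by linarith : (0 : ℝ) < m)]
  exact (div_le_self (abs_nonneg _) hm0).trans hmx
end

section
/- Let 0 ≤ A < B be integers. Then there exist an integer L ≥ 2 and integers a_j, b_j for 2 ≤ j ≤ L such that A = a₂ ≤ ⋯ ≤ a_L = b_L ≤ ⋯ ≤ b₂ = B, such that ε_i(a_j) = ε_i(b_j) = 0 for all 2 ≤ i < j ≤ L, and such that a_{j+1} − a_j ∈ {0, F_{j−1}} and b_j − b_{j+1} ∈ {0, F_j} for all 2 ≤ j < L. -/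
open scoped BigOperators

-- `zeps i n` is the `i`-th Zeckendorf digit `ε_i(n)` of `n`.
open Classical in
noncomputable def zeps (i n : ℕ) : ℕ :=
  if ∃ l : List ℕ, IsZeckRep l n ∧ i ∈ l then 1 else 0

/-- `n` has a Zeckendorf representation all of whose indices are at least `k`. -/
def ZeckFrom (k n : ℕ) : Prop :=
  ∃ l : List ℕ, IsZeckRep l n ∧ ∀ i ∈ l, k ≤ i

lemma isZeckRep_iff_pairwise {l : List ℕ} {n : ℕ} :
    IsZeckRep l n ↔ l.Pairwise (fun a b => b + 2 ≤ a) ∧ (∀ i ∈ l, 2 ≤ i) ∧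
      (l.map Nat.fib).sum = n := by
  have : IsTrans ℕ (fun a b => b + 2 ≤ a) := ⟨fun a b c h₁ h₂ => by omega⟩
  unfold IsZeckRep
  rw [← List.isChain_iff_pairwise]
  rfl

lemma IsZeckRep.eq_zeckendorf {l : List ℕ} {n : ℕ} (h : IsZeckRep l n) :
    l = n.zeckendorf := by
  obtain ⟨hp, h2, rfl⟩ := isZeckRep_iff_pairwise.1 h
  refine (Nat.zeckendorf_sum_fib ?_).symm
  refine List.Pairwise.isChain (List.pairwise_append.2 ⟨hp, by simp, ?_⟩)
  simpa using h2

lemma exists_isZeckRep (n : ℕ) : ∃ l, IsZeckRep l n := by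
  have h := Nat.isZeckendorfRep_zeckendorf n
  have : IsTrans ℕ (fun a b => b + 2 ≤ a) := ⟨fun a b c h₁ h₂ => by omega⟩
  have hp := List.pairwise_append.1 (List.isChain_iff_pairwise.1 h)
  exact ⟨n.zeckendorf, isZeckRep_iff_pairwise.2
    ⟨hp.1, fun i hi => by simpa using hp.2.2 i hi 0 (by simp), Nat.sum_zeckendorf_fib n⟩⟩

namespace ZeckFrom

lemma two (n : ℕ) : ZeckFrom 2 n := by
  obtain ⟨l, hl⟩ := exists_isZeckRep n
  exact ⟨l, hl, hl.2.1⟩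

lemma mono {j k n : ℕ} (hjk : j ≤ k) (h : ZeckFrom k n) : ZeckFrom j n := by
  obtain ⟨l, hl, hk⟩ := h
  exact ⟨l, hl, fun i hi => hjk.trans (hk i hi)⟩

lemma zeps_eq_zero {i k n : ℕ} (h : ZeckFrom k n) (hik : i < k) : zeps i n = 0 := by
  obtain ⟨l, hl, hk⟩ := h
  refine if_neg ?_
  rintro ⟨l', hl', hi⟩
  rw [hl'.eq_zeckendorf, ← hl.eq_zeckendorf] at hi
  exact absurd (hk i hi) (by omega)

lemma eq_zero_of_lt {k n : ℕ} (h : ZeckFrom k n) (hn : n < Nat.fib k) : n = 0 := by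
  obtain ⟨l, ⟨-, -, rfl⟩, hk⟩ := h
  rcases l with _ | ⟨x, l⟩
  · simp
  · have := Nat.fib_mono (hk x (by simp))
    simp only [List.map_cons, List.sum_cons] at hn
    omega

lemma cases_digit {k n : ℕ} (h : ZeckFrom k n) :
    ZeckFrom (k + 1) n ∨ ∃ m, ZeckFrom (k + 2) m ∧ n = m + Nat.fib k := by
  obtain ⟨l, hl, hk⟩ := h
  obtain ⟨hp, h2, hs⟩ := isZeckRep_iff_pairwise.1 hl
  rcases List.eq_nil_or_concat' l with rfl | ⟨l', x, rfl⟩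
  · exact Or.inl ⟨[], hl, by simp⟩
  obtain ⟨hp', -, hx⟩ := List.pairwise_append.1 hp
  have hx' : ∀ i ∈ l', x + 2 ≤ i := fun i hi => hx i hi x (by simp)
  have hkx : k ≤ x := hk x (by simp)
  rcases hkx.eq_or_lt with rfl | hlt
  · refine Or.inr ⟨(l'.map Nat.fib).sum, ⟨l', isZeckRep_iff_pairwise.2
      ⟨hp', fun i hi => h2 i (by simp [hi]), rfl⟩, hx'⟩, ?_⟩
    simpa using hs.symm
  · refine Or.inl ⟨_, hl, fun i hi => ?_⟩
    rcases List.mem_append.1 hi with hi | hi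
    · have := hx' i hi
      omega
    · rw [List.mem_singleton.1 hi]
      exact hlt

lemma add_fib_of_add_two {k m : ℕ} (hk : 2 ≤ k) (h : ZeckFrom (k + 2) m) :
    ZeckFrom k (m + Nat.fib k) := by
  obtain ⟨l, hl, hkl⟩ := h
  obtain ⟨hp, h2, hs⟩ := isZeckRep_iff_pairwise.1 hl
  refine ⟨l ++ [k], isZeckRep_iff_pairwise.2
    ⟨List.pairwise_append.2 ⟨hp, by simp, by simpa using hkl⟩, fun i hi => ?_, by simp [hs]⟩,
    fun i hi => ?_⟩ <;>
  · rcases List.mem_append.1 hi with hi | hi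
    · have := hkl i hi
      omega
    · have := List.mem_singleton.1 hi
      omega

lemma add_fib {k m : ℕ} (hk : 2 ≤ k) (h : ZeckFrom (k + 1) m) :
    ZeckFrom k (m + Nat.fib k) := by
  induction m using Nat.strong_induction_on generalizing k with
  | _ m ih =>
    rcases h.cases_digit with h | ⟨m', h', rfl⟩
    · exact add_fib_of_add_two hk h
    · have hpos : 0 < Nat.fib (k + 1) := Nat.fib_pos.2 (by omega)
      have := ih m' (by omega) (k := k + 2) (by omega) h'
      rw [Nat.fib_add_two, add_comm (Nat.fib k), ← add_assoc] at this
      exact this.mono (by omega)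

/-- Distinct elements of `ZeckFrom (k + 1)` are at least `fib k` apart. -/
lemma add_fib_le {k s t : ℕ} (hs : ZeckFrom (k + 1) s) (ht : ZeckFrom (k + 1) t)
    (hst : s < t) : s + Nat.fib k ≤ t := by
  obtain ⟨d, hd⟩ : ∃ d, t < Nat.fib (k + 1 + d) :=
    ⟨t + 5, (Nat.le_fib_self (by omega : 5 ≤ k + 1 + (t + 5))).trans_lt' (by omega)⟩
  induction d generalizing k s t with
  | zero =>
    have := ht.eq_zero_of_lt hd
    omega
  | succ d ih =>
    have ih₁ : ∀ {s t}, ZeckFrom (k + 2) s → ZeckFrom (k + 2) t → s < t →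
        t < Nat.fib (k + 1 + (d + 1)) → s + Nat.fib (k + 1) ≤ t := fun hs ht h hd =>
      ih hs ht h (by rwa [show k + 1 + 1 + d = k + 1 + (d + 1) by omega])
    have ih₂ : ∀ {s t}, ZeckFrom (k + 3) s → ZeckFrom (k + 3) t → s < t →
        t < Nat.fib (k + 1 + (d + 1)) → s + Nat.fib (k + 2) ≤ t := fun hs ht h hd =>
      ih hs ht h (hd.trans_le (Nat.fib_mono (by omega)))
    have hf : Nat.fib (k + 2) = Nat.fib k + Nat.fib (k + 1) := Nat.fib_add_two
    have hle : Nat.fib k ≤ Nat.fib (k + 1) := Nat.fib_le_fib_succ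
    rcases hs.cases_digit with hs₁ | ⟨s', hs', rfl⟩
    · rcases ht.cases_digit with ht₁ | ⟨t', ht', rfl⟩
      · have := ih₁ hs₁ ht₁ hst hd
        omega
      · rcases le_or_gt s t' with h | h
        · omega
        · have := ih₁ (ht'.mono (by omega)) hs₁ h (by omega)
          omega
    · rcases ht.cases_digit with ht₁ | ⟨t', ht', rfl⟩
      · rcases ht₁.cases_digit with ht₂ | ⟨t', ht', rfl⟩
        · have := ih₂ hs' ht₂ (by omega) hd
          omega
        · have hf' : Nat.fib (k + 1 + 1) = Nat.fib k + Nat.fib (k + 1) := hf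
          rcases le_or_gt s' t' with h | h
          · omega
          · have := ih₂ (ht'.mono (by omega)) hs' h (by omega)
            omega
      · have := ih₂ hs' ht' (by omega) (by omega)
        omega

/-- One step of the construction: clear the `j`-th digit of `a` from above and of `b` from
below. -/
lemma exists_step {j a b : ℕ} (hj : 2 ≤ j) (ha : ZeckFrom j a) (hb : ZeckFrom j b)
    (hab : a < b) :
    ∃ a' b', ZeckFrom (j + 1) a' ∧ ZeckFrom (j + 1) b' ∧ a' ≤ b' ∧
      (a' = a ∨ a' = a + Nat.fib (j - 1)) ∧ (b = b' ∨ b = b' + Nat.fib j) := by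
  have hf : Nat.fib (j + 1) = Nat.fib (j - 1) + Nat.fib j := by
    obtain ⟨i, rfl⟩ : ∃ i, j = i + 1 := ⟨j - 1, by omega⟩
    exact Nat.fib_add_two
  have hle : Nat.fib (j - 1) ≤ Nat.fib j := Nat.fib_mono (by omega)
  rcases ha.cases_digit with ha₁ | ⟨s, hs, rfl⟩ <;>
    rcases hb.cases_digit with hb₁ | ⟨t, ht, rfl⟩
  · exact ⟨a, b, ha₁, hb₁, hab.le, Or.inl rfl, Or.inl rfl⟩
  · refine ⟨a, t, ha₁, ht.mono (by omega), ?_, Or.inl rfl, Or.inr rfl⟩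
    by_contra! h
    have := add_fib_le (ht.mono (by omega)) ha₁ h
    omega
  · have hs' : ZeckFrom (j + 1) (s + Nat.fib (j + 1)) := hs.add_fib (by omega)
    refine ⟨_, b, hs', hb₁, ?_, Or.inr (by omega), Or.inl rfl⟩
    by_contra! h
    have := add_fib_le hb₁ hs' h
    omega
  · exact ⟨_, t, hs.add_fib (by omega), ht.mono (by omega),
      add_fib_le hs ht (by omega), Or.inr (by omega), Or.inr rfl⟩

lemma exists_sequences {j A B : ℕ} (hj : 2 ≤ j) (hA : ZeckFrom j A) (hB : ZeckFrom j B)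
    (hAB : A ≤ B) :
    ∃ L, j ≤ L ∧ ∃ a b : ℕ → ℕ, a j = A ∧ b j = B ∧ a L = b L ∧
      (∀ i, j ≤ i → i ≤ L → ZeckFrom i (a i) ∧ ZeckFrom i (b i)) ∧
      ∀ i, j ≤ i → i < L → (a (i + 1) = a i ∨ a (i + 1) = a i + Nat.fib (i - 1)) ∧
        (b i = b (i + 1) ∨ b i = b (i + 1) + Nat.fib i) := by
  obtain ⟨d, hd⟩ : ∃ d, B < Nat.fib (j + d) :=
    ⟨B + 5, (Nat.le_fib_self (by omega : 5 ≤ j + (B + 5))).trans_lt' (by omega)⟩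
  induction d generalizing j A B with
  | zero =>
    obtain rfl := hB.eq_zero_of_lt hd
    obtain rfl : A = 0 := by omega
    refine ⟨j, le_rfl, fun _ => 0, fun _ => 0, rfl, rfl, rfl, fun i hi hi' => ?_,
      fun i hi hi' => by omega⟩
    obtain rfl : i = j := by omega
    exact ⟨hA, hB⟩
  | succ d ih =>
    rcases hAB.eq_or_lt with rfl | hlt
    · refine ⟨j, le_rfl, fun _ => A, fun _ => A, rfl, rfl, rfl, fun i hi hi' => ?_,
        fun i hi hi' => by omega⟩
      obtain rfl : i = j := by omega
      exact ⟨hA, hB⟩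
    · obtain ⟨A', B', hA', hB', hle, hsA, hsB⟩ := exists_step hj hA hB hlt
      obtain ⟨L, hL, a, b, rfl, rfl, hab, hz, hs⟩ := ih (by omega) hA' hB' hle
        (by rw [show j + 1 + d = j + (d + 1) by omega]; omega)
      refine ⟨L, by omega, Function.update a j A, Function.update b j B, by simp, by simp,
        ?_, fun i hi hi' => ?_, fun i hi hi' => ?_⟩
      · rwa [Function.update_of_ne (by omega), Function.update_of_ne (by omega)]
      · rcases hi.eq_or_lt with rfl | hi
        · simpa using ⟨hA, hB⟩
        · rw [Function.update_of_ne (by omega), Function.update_of_ne (by omega)]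
          exact hz i hi hi'
      · rw [Function.update_of_ne (show i + 1 ≠ j by omega),
          Function.update_of_ne (show i + 1 ≠ j by omega)]
        rcases hi.eq_or_lt with rfl | hi
        · simpa using ⟨hsA, hsB⟩
        · rw [Function.update_of_ne (by omega), Function.update_of_ne (by omega)]
          exact hs i hi hi'

end ZeckFrom

theorem stmt_13 (A B : ℕ) (hAB : A < B) :
    ∃ L : ℕ, 2 ≤ L ∧ ∃ a b : ℕ → ℕ,
      a 2 = A ∧ b 2 = B ∧ a L = b L ∧
      (∀ j, 2 ≤ j → j < L → a j ≤ a (j + 1) ∧ b (j + 1) ≤ b j) ∧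
      (∀ i j, 2 ≤ i → i < j → j ≤ L → zeps i (a j) = 0 ∧ zeps i (b j) = 0) ∧
      (∀ j, 2 ≤ j → j < L →
        (a (j + 1) = a j ∨ a (j + 1) = a j + Nat.fib (j - 1)) ∧
        (b j = b (j + 1) ∨ b j = b (j + 1) + Nat.fib j)) := by
  obtain ⟨L, hL, a, b, ha, hb, hab, hz, hs⟩ :=
    ZeckFrom.exists_sequences le_rfl (ZeckFrom.two A) (ZeckFrom.two B) hAB.le
  refine ⟨L, hL, a, b, ha, hb, hab, fun j hj hjL => ?_, fun i j hi hij hjL => ?_, hs⟩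
  · have := hs j hj hjL
    omega
  · obtain ⟨h₁, h₂⟩ := hz j (by omega) hjL
    exact ⟨h₁.zeps_eq_zero hij, h₂.zeps_eq_zero hij⟩
end

section
/- Let f : ℝ⁺ → ℝ be twice continuously differentiable with f, f', f'' > 0, and suppose there exist constants c₁ ≥ 1/2 and c₂ > 0 such that c₁ f''(x) ≤ f''(y) ≤ c₂ f''(x) whenever 0 < x ≤ y ≤ 2x. Then there exist positive constants C₁ and C₂ (depending only on f) such that for all x ≥ 2, C₁·x·f''(x) ≤ f'(x) ≤ C₂·x·f''(x)·log x. -/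
/-- Mean value theorem on `[a, b] ⊆ (0, ∞)` for a function whose derivative is positive there. -/
lemma exists_sub_eq_mul_deriv_of_deriv_pos {g : ℝ → ℝ} (hg : ∀ x : ℝ, 0 < x → 0 < deriv g x)
    {a b : ℝ} (ha : 0 < a) (hab : a < b) :
    ∃ ξ, a ≤ ξ ∧ ξ ≤ b ∧ g b - g a = (b - a) * deriv g ξ := by
  have hd : ∀ x : ℝ, 0 < x → DifferentiableAt ℝ g x := fun x hx =>
    differentiableAt_of_deriv_ne_zero (hg x hx).ne'
  obtain ⟨ξ, hξ, h⟩ := exists_deriv_eq_slope g hab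
    (fun x hx => (hd x (ha.trans_le hx.1)).continuousAt.continuousWithinAt)
    (fun x hx => (hd x (ha.trans hx.1)).differentiableWithinAt)
  refine ⟨ξ, hξ.1.le, hξ.2.le, ?_⟩
  rw [h, mul_div_cancel₀ _ (sub_pos.2 hab).ne']

/-- If `g' > 0` and `g' x ≤ 2 g' y` for `0 < x ≤ y ≤ 2x`, then `g x = O(x g' x log x)`. -/
lemma exists_le_mul_deriv_mul_log {g : ℝ → ℝ} (hpos : ∀ x : ℝ, 0 < x → 0 < g x)
    (hg : ∀ x : ℝ, 0 < x → 0 < deriv g x)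
    (hreg : ∀ x y : ℝ, 0 < x → x ≤ y → y ≤ 2 * x → deriv g x ≤ 2 * deriv g y) :
    ∃ C : ℝ, 0 < C ∧ ∀ x : ℝ, 2 ≤ x → g x ≤ C * x * deriv g x * Real.log x := by
  have hlog : 0 < Real.log 2 := Real.log_pos (by norm_num)
  have h2 := hg 2 (by norm_num)
  have h4 := hpos 4 (by norm_num)
  set C := g 4 / (deriv g 2 * Real.log 2) + 1 / Real.log 2 with hC
  have hCpos : 0 < C := by positivity
  have hC1 : 1 ≤ C * Real.log 2 := by
    have : C * Real.log 2 = g 4 / deriv g 2 + 1 := by rw [hC]; field_simp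
    have : 0 < g 4 / deriv g 2 := by positivity
    linarith
  have hC4 : g 4 ≤ C * deriv g 2 * Real.log 2 := by
    have : C * deriv g 2 * Real.log 2 = g 4 + deriv g 2 := by rw [hC]; field_simp
    linarith
  have base : ∀ x : ℝ, 2 ≤ x → x ≤ 4 → g x ≤ C * x * deriv g x * Real.log x := by
    intro x hx hx4
    have hgx : g x ≤ g 4 := by
      rcases hx4.eq_or_lt with rfl | hlt
      · exact le_rfl
      · obtain ⟨ξ, h₁, -, h⟩ := exists_sub_eq_mul_deriv_of_deriv_pos hg (by linarith) hlt
        have := mul_pos (sub_pos.2 hlt) (hg ξ (by linarith))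
        linarith
    have hd : deriv g 2 ≤ x * deriv g x := by
      have := hreg 2 x (by norm_num) hx (by linarith)
      have := mul_le_mul_of_nonneg_right hx (hg x (by linarith)).le
      linarith
    calc g x ≤ C * deriv g 2 * Real.log 2 := hgx.trans hC4
      _ ≤ C * (x * deriv g x) * Real.log x := by
        have := hg x (by linarith)
        gcongr
      _ = _ := by ring
  have key : ∀ n : ℕ, ∀ x : ℝ, 2 ≤ x → x ≤ 4 * 2 ^ n →
      g x ≤ C * x * deriv g x * Real.log x := by
    intro n
    induction n with
    | zero => intro x hx hx4; exact base x hx (by simpa using hx4)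
    | succ n ih =>
      intro x hx hxn
      rcases le_total x 4 with hx4 | hx4
      · exact base x hx hx4
      obtain ⟨y, rfl⟩ : ∃ y, x = 2 * y := ⟨x / 2, by ring⟩
      have hy : 2 ≤ y := by linarith
      have hi := ih y hy (by rw [pow_succ] at hxn; linarith)
      obtain ⟨ξ, h₁, h₂, h⟩ := exists_sub_eq_mul_deriv_of_deriv_pos hg
        (show 0 < y by linarith) (show y < 2 * y by linarith)
      have hξ := hreg ξ (2 * y) (by linarith) h₂ (by linarith)
      have hyy := hreg y (2 * y) (by linarith) (by linarith) le_rfl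
      have hp := hg (2 * y) (by linarith)
      have hly : 0 ≤ Real.log y := Real.log_nonneg (by linarith)
      rw [Real.log_mul (by norm_num) (by linarith)]
      have e1 : (2 * y - y) * deriv g ξ ≤ y * (2 * deriv g (2 * y)) := by
        rw [show 2 * y - y = y by ring]
        gcongr
      have e2 : C * y * deriv g y * Real.log y ≤ C * y * (2 * deriv g (2 * y)) * Real.log y := by
        gcongr
      have e3 : y * (2 * deriv g (2 * y)) * 1 ≤
          y * (2 * deriv g (2 * y)) * (C * Real.log 2) := by
        gcongr
      linarith
  refine ⟨C, hCpos, fun x hx => ?_⟩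
  obtain ⟨n, hn⟩ := pow_unbounded_of_one_lt x (one_lt_two : (1 : ℝ) < 2)
  exact key n x hx (by linarith [pow_pos (two_pos : (0 : ℝ) < 2) n])

theorem stmt_15 (f : ℝ → ℝ)
    (hf : ContDiffOn ℝ 2 f (Set.Ioi 0))
    (hfpos : ∀ x : ℝ, 0 < x → 0 < f x)
    (hf'pos : ∀ x : ℝ, 0 < x → 0 < deriv f x)
    (hf''pos : ∀ x : ℝ, 0 < x → 0 < deriv (deriv f) x)
    (c₁ c₂ : ℝ) (hc₁ : 1 / 2 ≤ c₁) (hc₂ : 0 < c₂)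
    (hreg : ∀ x y : ℝ, 0 < x → x ≤ y → y ≤ 2 * x →
      c₁ * deriv (deriv f) x ≤ deriv (deriv f) y ∧
        deriv (deriv f) y ≤ c₂ * deriv (deriv f) x) :
    ∃ C₁ C₂ : ℝ, 0 < C₁ ∧ 0 < C₂ ∧ ∀ x : ℝ, 2 ≤ x →
      C₁ * x * deriv (deriv f) x ≤ deriv f x ∧
      deriv f x ≤ C₂ * x * deriv (deriv f) x * Real.log x := by
  obtain ⟨C, hC, hupper⟩ := exists_le_mul_deriv_mul_log hf'pos hf''pos fun x y hx hxy hy => by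
    have h₁ := (hreg x y hx hxy hy).1
    have h₂ := mul_le_mul_of_nonneg_right hc₁ (hf''pos x hx).le
    linarith
  refine ⟨1 / (2 * c₂), C, by positivity, hC, fun x hx => ⟨?_, hupper x hx⟩⟩
  obtain ⟨ξ, h₁, h₂, h⟩ := exists_sub_eq_mul_deriv_of_deriv_pos hf''pos
    (show 0 < x / 2 by linarith) (show x / 2 < x by linarith)
  have hξ := (hreg ξ x (by linarith) h₂ (by linarith)).2
  have hhalf := hf'pos (x / 2) (by linarith)
  calc 1 / (2 * c₂) * x * deriv (deriv f) x
      ≤ 1 / (2 * c₂) * x * (c₂ * deriv (deriv f) ξ) := by gcongr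
    _ = (x - x / 2) * deriv (deriv f) ξ := by field_simp; ring
    _ ≤ deriv f x := by linarith
end

section
/- Let f : [a,b] → ℝ be twice differentiable with |f''(t)| ≤ M for all t ∈ [a,b]. Then for every α in the image f'([a,b]) and every x with a ≤ x ≤ b such that ‖x·α + f(a) − a·α‖ > M·(b − a)², one has ⌊f(x)⌋ = ⌊x·α + f(a) − a·α⌋. -/
/-- `nint x` is the distance from `x` to the nearest integer. -/
noncomputable def nint (x : ℝ) : ℝ := |x - round x|

/-- A real number closer to `y` than the nearest integer has the same floor as `y`. -/
theorem floor_eq_floor_of_abs_sub_lt_nint {y z : ℝ} (h : |z - y| < nint y) : ⌊z⌋ = ⌊y⌋ := by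
  have h₀ : nint y ≤ |y - (⌊y⌋ : ℤ)| := round_le y ⌊y⌋
  have h₁ : nint y ≤ |y - ((⌊y⌋ + 1 : ℤ) : ℝ)| := round_le y (⌊y⌋ + 1)
  push_cast at h₁
  have hl := Int.floor_le y
  have hu := Int.lt_floor_add_one y
  rw [abs_of_nonneg (by linarith)] at h₀
  rw [abs_of_nonpos (by linarith)] at h₁
  rw [abs_lt] at h
  rw [Int.floor_eq_iff]
  constructor <;> linarith [h.1, h.2]

/-- The error of the affine approximation of `f` at `a` with slope any value of the derivative
is at most `M * (b - a) ^ 2` when the second derivative is bounded by `M`. -/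
theorem abs_sub_affine_le {a b M : ℝ} {f f' f'' : ℝ → ℝ}
    (hf' : ∀ t ∈ Set.Icc a b, HasDerivWithinAt f (f' t) (Set.Icc a b) t)
    (hf'' : ∀ t ∈ Set.Icc a b, HasDerivWithinAt f' (f'' t) (Set.Icc a b) t)
    (hM : ∀ t ∈ Set.Icc a b, |f'' t| ≤ M)
    {c x : ℝ} (hc : c ∈ Set.Icc a b) (hx : x ∈ Set.Icc a b) :
    |f x - (x * f' c + f a - a * f' c)| ≤ M * (b - a) ^ 2 := by
  have hab : a ≤ b := hx.1.trans hx.2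
  have hM₀ : 0 ≤ M := (abs_nonneg _).trans (hM x hx)
  have hbound : ∀ t ∈ Set.Icc a b, ‖f' t - f' c‖ ≤ M * (b - a) := fun t ht => by
    have htc : ‖t - c‖ ≤ b - a := by
      rw [Real.norm_eq_abs, abs_le]
      constructor <;> linarith [ht.1, ht.2, hc.1, hc.2]
    exact ((convex_Icc a b).norm_image_sub_le_of_norm_hasDerivWithin_le hf'' hM hc ht).trans
      (mul_le_mul_of_nonneg_left htc hM₀)
  have hg : ∀ t ∈ Set.Icc a b,
      HasDerivWithinAt (fun s => f s - s * f' c) (f' t - f' c) (Set.Icc a b) t := fun t ht => by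
    have h := (hf' t ht).sub ((hasDerivWithinAt_id t (Set.Icc a b)).mul_const (f' c))
    rw [one_mul] at h
    exact h
  have key := (convex_Icc a b).norm_image_sub_le_of_norm_hasDerivWithin_le hg hbound
    (Set.left_mem_Icc.2 hab) hx
  have hxa : ‖x - a‖ ≤ b - a := by
    rw [Real.norm_eq_abs, abs_of_nonneg (by linarith [hx.1])]
    linarith [hx.2]
  calc |f x - (x * f' c + f a - a * f' c)|
      = ‖f x - x * f' c - (f a - a * f' c)‖ := by rw [Real.norm_eq_abs]; congr 1; ring
    _ ≤ M * (b - a) * ‖x - a‖ := key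
    _ ≤ M * (b - a) * (b - a) :=
        mul_le_mul_of_nonneg_left hxa (mul_nonneg hM₀ (sub_nonneg.2 hab))
    _ = M * (b - a) ^ 2 := by ring

theorem stmt_17 (a b M : ℝ) (hab : a ≤ b) (f f' f'' : ℝ → ℝ)
    (hf' : ∀ t ∈ Set.Icc a b, HasDerivWithinAt f (f' t) (Set.Icc a b) t)
    (hf'' : ∀ t ∈ Set.Icc a b, HasDerivWithinAt f' (f'' t) (Set.Icc a b) t)
    (hM : ∀ t ∈ Set.Icc a b, |f'' t| ≤ M)
    (α : ℝ) (hα : α ∈ f' '' Set.Icc a b)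
    (x : ℝ) (hx : x ∈ Set.Icc a b)
    (hfar : M * (b - a) ^ 2 < nint (x * α + f a - a * α)) :
    ⌊f x⌋ = ⌊x * α + f a - a * α⌋ := by
  obtain ⟨c, hc, rfl⟩ := hα
  exact floor_eq_floor_of_abs_sub_lt_nint
    ((abs_sub_affine_le hf' hf'' hM hc hx).trans_lt hfar)
end
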